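/- arXiv:1902.00635 — 7 statements merged into one kernel-verified Lean document; each statement's English description precedes it below -/
import Mathlib

section
/- Under the SGD setting, let R ∈ (R₀, R₁] and let η ≤ η₀ := min{1/(2γ), 3R/(8b), (3γR²/8 − 2bR)/(2γbR + b²)}. Then for every sequence (ξ_n) in Ξ and every initial point X₀ = x in the closed ball B(0,R), the SGD iterates X_{n+1} = X_n − η∇f(X_n; ξ_n) satisfy X_n ∈ B(0,R) for all n ≥ 0; that is, the SGD sequence is uniformly bounded in both n and the realization of the noise. -/
open Metric

open scoped RealInnerProductSpace in
/-- The gradient of a differentiable convex function is monotone. -/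
theorem ConvexOn.inner_gradient_sub_nonneg {E : Type*} [NormedAddCommGroup E]
    [InnerProductSpace ℝ E] [CompleteSpace E] {s : Set E} {f : E → ℝ} {x y gx gy : E}
    (hf : ConvexOn ℝ s f) (hx : x ∈ s) (hy : y ∈ s)
    (hgx : HasGradientAt f gx x) (hgy : HasGradientAt f gy y) :
    0 ≤ ⟪gy - gx, y - x⟫ := by
  have hφ := hf.comp_affineMap (AffineMap.lineMap x y : ℝ →ᵃ[ℝ] E)
  have hderiv : ∀ (t : ℝ) (g : E), HasGradientAt f g (AffineMap.lineMap x y t) →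
      HasDerivAt (f ∘ (AffineMap.lineMap x y : ℝ →ᵃ[ℝ] E)) ⟪g, y - x⟫ t := fun t g hg => by
    simpa using hg.hasFDerivAt.comp_hasDerivAt t AffineMap.hasDerivAt_lineMap
  have h0 := hφ.le_slope_of_hasDerivAt (x := 0) (y := 1) (by simpa) (by simpa) one_pos
    (hderiv 0 gx (by simpa))
  have h1 := hφ.slope_le_of_hasDerivAt (x := 0) (y := 1) (by simpa) (by simpa) one_pos
    (hderiv 1 gy (by simpa))
  rw [inner_sub_left]
  linarith

open scoped RealInnerProductSpace in
/-- The gradient of a strongly convex function is strongly monotone. -/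
theorem ConvexOn.mul_norm_sub_sq_le_inner_gradient_sub {E : Type*} [NormedAddCommGroup E]
    [InnerProductSpace ℝ E] [CompleteSpace E] {s : Set E} {f : E → ℝ} {γ : ℝ} {x y : E}
    (hf : ConvexOn ℝ s fun z => f z - γ / 2 * ‖z‖ ^ 2) (hx : x ∈ s) (hy : y ∈ s)
    (hdx : DifferentiableAt ℝ f x) (hdy : DifferentiableAt ℝ f y) :
    γ * ‖y - x‖ ^ 2 ≤ ⟪gradient f y - gradient f x, y - x⟫ := by
  have hgrad : ∀ z, DifferentiableAt ℝ f z →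
      HasGradientAt (fun z => f z - γ / 2 * ‖z‖ ^ 2) (gradient f z - γ • z) z := fun z hz => by
    rw [hasGradientAt_iff_hasFDerivAt]
    refine (hz.hasGradientAt.hasFDerivAt.sub
      ((hasStrictFDerivAt_norm_sq z).hasFDerivAt.const_mul (γ / 2))).congr_fderiv ?_
    ext w
    simp
    ring
  have h := hf.inner_gradient_sub_nonneg hx hy (hgrad x hdx) (hgrad y hdy)
  rw [show gradient f y - γ • y - (gradient f x - γ • x) =
      (gradient f y - gradient f x) - γ • (y - x) by module, inner_sub_left, real_inner_smul_left,
    real_inner_self_eq_norm_sq] at h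
  linarith

open scoped RealInnerProductSpace in
/-- A step `x - η • g` along a coercive direction `g` of linear growth stays in a large ball. -/
theorem norm_sub_smul_le_of_coercive {E : Type*} [NormedAddCommGroup E]
    [InnerProductSpace ℝ E] {γ b R η : ℝ} {x g : E} (hγ : 0 < γ) (hb : 0 < b) (hη : 0 < η)
    (hηγ : η ≤ 1 / (2 * γ)) (hηb : η ≤ 3 * R / (8 * b))
    (hηR : η ≤ (3 * γ * R ^ 2 / 8 - 2 * b * R) / (2 * γ * b * R + b ^ 2))
    (hx : ‖x‖ ≤ R) (hg : ‖g‖ ≤ b + γ * ‖x‖) (hinner : γ * ‖x‖ ^ 2 - b * ‖x‖ ≤ ⟪x, g⟫) :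
    ‖x - η • g‖ ≤ R := by
  have hr : 0 ≤ ‖x‖ := norm_nonneg x
  have hR : 0 ≤ R := hr.trans hx
  rw [le_div_iff₀ (by positivity)] at hηγ hηb hηR
  refine le_of_sq_le_sq ?_ hR
  rw [norm_sub_sq_real, inner_smul_right, norm_smul, Real.norm_of_nonneg hη.le]
  have hg2 : ‖g‖ ^ 2 ≤ (b + γ * ‖x‖) ^ 2 := by gcongr
  generalize ‖x‖ = r at *
  have hstep : r ^ 2 - 2 * (η * ⟪x, g⟫) + (η * ‖g‖) ^ 2 ≤
      r ^ 2 - 3 / 2 * (η * γ) * r ^ 2 + 2 * η * b * r + η ^ 2 * (b ^ 2 + 2 * b * γ * r) := by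
    have h1 := mul_le_mul_of_nonneg_left hinner hη.le
    have h2 := mul_le_mul_of_nonneg_left hg2 (sq_nonneg η)
    have h3 : η * γ * r ^ 2 * (η * (2 * γ)) ≤ η * γ * r ^ 2 * 1 := by gcongr
    linarith
  refine hstep.trans ?_
  rcases le_total (R / 2) r with hrR | hrR
  · have h1 : η * γ * (R / 2) ^ 2 ≤ η * γ * r ^ 2 := by gcongr
    have h2 : η * b * r ≤ η * b * R := by gcongr
    have h3 : η ^ 2 * (b ^ 2 + 2 * b * γ * r) ≤ η ^ 2 * (b ^ 2 + 2 * b * γ * R) := by gcongr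
    have h4 := mul_le_mul_of_nonneg_left hηR hη.le
    have h5 : r ^ 2 ≤ R ^ 2 := by gcongr
    linarith
  · have hc : η * b ≤ 3 / 8 * R := by linarith
    have h1 : (r + η * b) ^ 2 ≤ (7 / 8 * R) ^ 2 := by
      gcongr
      linarith
    have h2 : (η * b) ^ 2 ≤ (3 / 8 * R) ^ 2 := by gcongr
    have h3 := mul_nonneg (mul_pos hη hγ).le (sq_nonneg (3 * r - 2 * (η * b)))
    have h4 : (η * b) ^ 2 * (η * (2 * γ)) ≤ (η * b) ^ 2 * 1 := by gcongr
    nlinarith [sq_nonneg R]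

/-- **Uniform boundedness of SGD iterates** (Lemma `lmm:uniformbound`).
Under the SGD setting with local strong convexity, for `R ∈ (R₀, R₁]` and step size
`η ≤ η₀`, every realization of SGD started in the closed ball `B(0,R)` stays in `B(0,R)`. -/
theorem sgd_iterates_uniformly_bounded
    (d : ℕ) (hd : 1 ≤ d) (Ξ : Type) [Fintype Ξ] [Nonempty Ξ]
    (f : Ξ → EuclideanSpace ℝ (Fin d) → ℝ)
    (fbar : EuclideanSpace ℝ (Fin d) → ℝ)
    (hfbar : ∀ x, fbar x = (Fintype.card Ξ : ℝ)⁻¹ * ∑ ξ : Ξ, f ξ x)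
    (γ b R₁ : ℝ) (hγ : 0 < γ) (hb : 0 < b) (hR₁pos : 0 < R₁)
    (hR₀R₁ : 16 * b / (3 * γ) < R₁)
    (hsmooth : ∀ ξ : Ξ, ContDiff ℝ 1 (f ξ))
    (hconv : ∀ ξ : Ξ, ConvexOn ℝ (closedBall (0 : EuclideanSpace ℝ (Fin d)) R₁)
      (fun x => f ξ x - γ / 2 * ‖x‖ ^ 2))
    (hgrad0 : ∀ ξ : Ξ, ‖gradient (f ξ) (0 : EuclideanSpace ℝ (Fin d))‖ ≤ b)
    (hgradbd : ∀ ξ : Ξ, ∀ x ∈ closedBall (0 : EuclideanSpace ℝ (Fin d)) R₁,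
      ‖gradient (f ξ) x‖ ≤ b + γ * ‖x‖)
    (R : ℝ) (hR₀R : 16 * b / (3 * γ) < R) (hRR₁ : R ≤ R₁)
    (η : ℝ) (hηpos : 0 < η)
    (hη : η ≤ min (1 / (2 * γ))
      (min (3 * R / (8 * b)) ((3 * γ * R ^ 2 / 8 - 2 * b * R) / (2 * γ * b * R + b ^ 2))))
    (ξs : ℕ → Ξ) (X : ℕ → EuclideanSpace ℝ (Fin d))
    (hX0 : X 0 ∈ closedBall (0 : EuclideanSpace ℝ (Fin d)) R)
    (hXrec : ∀ n : ℕ, X (n + 1) = X n - η • gradient (f (ξs n)) (X n)) :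
    ∀ n : ℕ, X n ∈ closedBall (0 : EuclideanSpace ℝ (Fin d)) R := by
  have hball : closedBall (0 : EuclideanSpace ℝ (Fin d)) R ⊆ closedBall 0 R₁ :=
    closedBall_subset_closedBall hRR₁
  obtain ⟨hηγ, hηb, hηR⟩ := by simpa only [le_min_iff] using hη
  intro n
  induction n with
  | zero => exact hX0
  | succ n ih =>
    rw [hXrec]
    set x := X n
    set ξ := ξs n
    have hdiff : Differentiable ℝ (f ξ) := (hsmooth ξ).differentiable one_ne_zero
    have hmono := (hconv ξ).mul_norm_sub_sq_le_inner_gradient_sub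
      (mem_closedBall_self hR₁pos.le) (hball ih) (hdiff 0) (hdiff x)
    rw [sub_zero, inner_sub_left, real_inner_comm] at hmono
    have h0 : -(b * ‖x‖) ≤ inner ℝ (gradient (f ξ) 0) x :=
      (neg_le_neg (mul_le_mul_of_nonneg_right (hgrad0 ξ) (norm_nonneg x))).trans
        (neg_le_of_abs_le (abs_real_inner_le_norm _ _))
    rw [mem_closedBall_zero_iff] at ih ⊢
    exact norm_sub_smul_le_of_coercive hγ hb hηpos hηγ hηb hηR ih
      (hgradbd ξ x (hball (mem_closedBall_zero_iff.2 ih))) (by linarith)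
end

section
/- Under the SGD setting, let R ∈ (R₀, R₁], let η ≤ η₀ be small enough that ρ² := 1 − 2γη + η²L² ∈ (0,1), where L is a common Lipschitz constant of ∇f(·;ξ) on B(0,R), and let (ξ_n)_{n≥0} be i.i.d. uniform on Ξ. Let μ_n denote the law of the n-th SGD iterate X_n started from an initial law μ₀ supported in B(0,R). Then there exists a probability measure π on ℝ^d, independent of μ₀, and a constant C > 0 such that μ_n converges weakly (in distribution) to π as n → ∞; moreover, for every K-Lipschitz function φ : ℝ^d → ℝ, |∫φ dμ_n − ∫φ dπ| ≤ C K ρⁿ for all n. -/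
open Metric MeasureTheory Filter

/-- The SGD map applied along a finite list of noise realizations (earliest noise first). -/
noncomputable def sgdIter {d : ℕ} {Ξ : Type}
    (g : Ξ → EuclideanSpace ℝ (Fin d) → EuclideanSpace ℝ (Fin d)) (η : ℝ) :
    List Ξ → EuclideanSpace ℝ (Fin d) → EuclideanSpace ℝ (Fin d)
  | [], x => x
  | ξ :: l, x => sgdIter g η l (x - η • g ξ x)

/-- The law `μ_n` of the `n`-th SGD iterate started from the initial law `μ₀`, when the noise
is i.i.d. uniform on the finite set `Ξ`: the uniform mixture over all noise words `ω ∈ Ξⁿ`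
of the pushforward of `μ₀` by the corresponding deterministic `n`-fold SGD map. -/
noncomputable def sgdLaw {d : ℕ} {Ξ : Type} [Fintype Ξ]
    (g : Ξ → EuclideanSpace ℝ (Fin d) → EuclideanSpace ℝ (Fin d)) (η : ℝ)
    (μ₀ : Measure (EuclideanSpace ℝ (Fin d))) (n : ℕ) :
    Measure (EuclideanSpace ℝ (Fin d)) :=
  ((Fintype.card Ξ : ENNReal) ^ n)⁻¹ •
    ∑ ω : Fin n → Ξ, Measure.map (sgdIter g η (List.ofFn ω)) μ₀

/-- First-order characterization of convexity: the tangent at `x` lies below the function. -/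
theorem ConvexOn.fderiv_apply_sub_le {E : Type*} [NormedAddCommGroup E] [NormedSpace ℝ E]
    {s : Set E} {h : E → ℝ} (hc : ConvexOn ℝ s h) {x y : E} (hx : x ∈ s) (hy : y ∈ s)
    {h' : E →L[ℝ] ℝ} (hd : HasFDerivAt h h' x) : h' (y - x) ≤ h y - h x := by
  have hconv : ConvexOn ℝ (AffineMap.lineMap x y ⁻¹' s) (h ∘ AffineMap.lineMap x y) :=
    hc.comp_affineMap (AffineMap.lineMap (k := ℝ) x y)
  have hderiv : HasDerivAt (h ∘ AffineMap.lineMap (k := ℝ) x y) (h' (y - x)) 0 :=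
    HasFDerivAt.comp_hasDerivAt (0 : ℝ) (by simpa using hd) AffineMap.hasDerivAt_lineMap
  simpa [slope_def_field] using
    hconv.le_slope_of_hasDerivAt (by simpa using hx) (by simpa using hy) one_pos hderiv

/-- The gradient of a differentiable `γ`-strongly convex function is `γ`-strongly monotone. -/
theorem strongly_monotone_gradient {E : Type*} [NormedAddCommGroup E] [InnerProductSpace ℝ E]
    [CompleteSpace E] {s : Set E} {f : E → ℝ} {γ : ℝ} (hf : Differentiable ℝ f)
    (hc : ConvexOn ℝ s (fun x => f x - γ / 2 * ‖x‖ ^ 2)) {x y : E} (hx : x ∈ s) (hy : y ∈ s) :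
    γ * ‖x - y‖ ^ 2 ≤ inner ℝ (x - y) (gradient f x - gradient f y) := by
  have hderiv (z : E) : HasFDerivAt (fun x => f x - γ / 2 * ‖x‖ ^ 2)
      (fderiv ℝ f z - (γ / 2) • (2 • innerSL ℝ z)) z :=
    (hf z).hasFDerivAt.sub ((hasStrictFDerivAt_norm_sq z).hasFDerivAt.const_mul (γ / 2))
  have hgrad (z v : E) : fderiv ℝ f z v = inner ℝ v (gradient f z) := by
    rw [real_inner_comm, gradient, InnerProductSpace.toDual_symm_apply]
  have h1 := hc.fderiv_apply_sub_le hx hy (hderiv x)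
  have h2 := hc.fderiv_apply_sub_le hy hx (hderiv y)
  simp only [sub_apply, smul_apply, hgrad,
    innerSL_apply_apply, smul_eq_mul, nsmul_eq_mul, Nat.cast_ofNat] at h1 h2
  rw [← real_inner_self_eq_norm_sq]
  simp only [inner_sub_left, inner_sub_right, real_inner_comm x y] at h1 h2 ⊢
  nlinarith

section RandomIteration

variable {d : ℕ} {Ξ : Type}
  {g : Ξ → EuclideanSpace ℝ (Fin d) → EuclideanSpace ℝ (Fin d)} {η R ρ : ℝ}

theorem continuous_sgdIter (hg : ∀ ξ, Continuous (g ξ)) (l : List Ξ) :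
    Continuous (sgdIter g η l) := by
  induction l with
  | nil => exact continuous_id
  | cons ξ l ih => exact ih.comp (continuous_id.sub ((hg ξ).const_smul η))

theorem mapsTo_sgdIter {s : Set (EuclideanSpace ℝ (Fin d))}
    (hmaps : ∀ ξ, ∀ x ∈ s, x - η • g ξ x ∈ s) (l : List Ξ) :
    Set.MapsTo (sgdIter g η l) s s := by
  induction l with
  | nil => exact Set.mapsTo_id s
  | cons ξ l ih => exact fun x hx => ih (hmaps ξ x hx)

theorem dist_sgdIter_le {s : Set (EuclideanSpace ℝ (Fin d))}
    (hmaps : ∀ ξ, ∀ x ∈ s, x - η • g ξ x ∈ s) (hρ : 0 ≤ ρ)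
    (hcontr : ∀ ξ, ∀ x ∈ s, ∀ y ∈ s, dist (x - η • g ξ x) (y - η • g ξ y) ≤ ρ * dist x y)
    (l : List Ξ) {x y : EuclideanSpace ℝ (Fin d)} (hx : x ∈ s) (hy : y ∈ s) :
    dist (sgdIter g η l x) (sgdIter g η l y) ≤ ρ ^ l.length * dist x y := by
  induction l generalizing x y with
  | nil => simp [sgdIter]
  | cons ξ l ih =>
    calc dist (sgdIter g η (ξ :: l) x) (sgdIter g η (ξ :: l) y)
        ≤ ρ ^ l.length * dist (x - η • g ξ x) (y - η • g ξ y) :=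
          ih (hmaps ξ x hx) (hmaps ξ y hy)
      _ ≤ ρ ^ l.length * (ρ * dist x y) := by gcongr; exact hcontr ξ x hx y hy
      _ = ρ ^ (ξ :: l).length * dist x y := by rw [List.length_cons, pow_succ]; ring

/-- The backward iteration: the first `n` noises are applied with the latest one first. -/
noncomputable def backwardIter (g : Ξ → EuclideanSpace ℝ (Fin d) → EuclideanSpace ℝ (Fin d))
    (η : ℝ) (n : ℕ) (ω : ℕ → Ξ) : EuclideanSpace ℝ (Fin d) → EuclideanSpace ℝ (Fin d) :=
  sgdIter g η (List.ofFn fun i : Fin n => ω i.rev)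

theorem backwardIter_succ (n : ℕ) (ω : ℕ → Ξ) (x : EuclideanSpace ℝ (Fin d)) :
    backwardIter g η (n + 1) ω x = backwardIter g η n ω (x - η • g (ω n) x) := by
  simp [backwardIter, List.ofFn_succ, sgdIter]

theorem exists_backwardIter_add_eq {s : Set (EuclideanSpace ℝ (Fin d))}
    (hmaps : ∀ ξ, ∀ x ∈ s, x - η • g ξ x ∈ s) (n k : ℕ) (ω : ℕ → Ξ)
    {x : EuclideanSpace ℝ (Fin d)} (hx : x ∈ s) :
    ∃ y ∈ s, backwardIter g η (n + k) ω x = backwardIter g η n ω y := by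
  induction k generalizing x with
  | zero => exact ⟨x, hx, rfl⟩
  | succ k ih =>
    obtain ⟨y, hy, h⟩ := ih (hmaps (ω (n + k)) x hx)
    exact ⟨y, hy, by rw [← h, ← add_assoc, backwardIter_succ]⟩

/-- On a ball that is invariant under uniform contractions, the backward iterates converge
geometrically to a limit which does not depend on the starting point. -/
theorem exists_limit_backwardIter (hR : 0 ≤ R)
    (hmaps : ∀ ξ, ∀ x ∈ closedBall 0 R, x - η • g ξ x ∈ closedBall 0 R)
    (hρ : 0 ≤ ρ) (hρ1 : ρ < 1)
    (hcontr : ∀ ξ, ∀ x ∈ closedBall 0 R, ∀ y ∈ closedBall 0 R,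
      dist (x - η • g ξ x) (y - η • g ξ y) ≤ ρ * dist x y) (ω : ℕ → Ξ) :
    ∃ z ∈ closedBall 0 R, ∀ n, ∀ x ∈ closedBall 0 R,
      dist (backwardIter g η n ω x) z ≤ 2 * R * ρ ^ n := by
  have hpair (n : ℕ) : ∀ x ∈ closedBall 0 R, ∀ y ∈ closedBall 0 R,
      dist (backwardIter g η n ω x) (backwardIter g η n ω y) ≤ 2 * R * ρ ^ n := by
    intro x hx y hy
    have h := dist_sgdIter_le hmaps hρ hcontr (List.ofFn fun i : Fin n => ω i.rev) hx hy
    rw [List.length_ofFn] at h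
    have hxy : dist x y ≤ 2 * R := by
      linarith [dist_triangle_right x y 0, mem_closedBall.1 hx, mem_closedBall.1 hy]
    calc _ ≤ ρ ^ n * dist x y := h
      _ ≤ ρ ^ n * (2 * R) := by gcongr
      _ = _ := mul_comm _ _
  have h0 : (0 : EuclideanSpace ℝ (Fin d)) ∈ closedBall 0 R := mem_closedBall_self hR
  have htail (n k : ℕ) : ∀ x ∈ closedBall 0 R,
      dist (backwardIter g η n ω x) (backwardIter g η (n + k) ω 0) ≤ 2 * R * ρ ^ n := by
    intro x hx
    obtain ⟨y, hy, h⟩ := exists_backwardIter_add_eq hmaps n k ω h0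
    rw [h]
    exact hpair n x hx y hy
  have hcauchy : CauchySeq fun n => backwardIter g η n ω 0 :=
    cauchySeq_of_le_geometric ρ (2 * R) hρ1 fun n => htail n 1 0 h0
  obtain ⟨z, hz⟩ := cauchySeq_tendsto_of_complete hcauchy
  refine ⟨z, isClosed_closedBall.mem_of_tendsto hz
    (Eventually.of_forall fun n => mapsTo_sgdIter hmaps _ h0), fun n x hx => ?_⟩
  have hshift : Tendsto (fun k => backwardIter g η (n + k) ω 0) atTop (nhds z) := by
    simpa only [add_comm n] using (tendsto_add_atTop_iff_nat n).2 hz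
  exact le_of_tendsto (tendsto_const_nhds.dist hshift)
    (Eventually.of_forall fun k => htail n k x hx)

/-- Reversing the first `n` coordinates of an i.i.d. sequence yields a product law. -/
theorem map_rev_infinitePi [MeasurableSpace Ξ] (ν : Measure Ξ) [IsProbabilityMeasure ν] (n : ℕ) :
    (Measure.infinitePi fun _ : ℕ => ν).map (fun ω (i : Fin n) => ω i.rev) =
      Measure.pi fun _ : Fin n => ν := by
  have hindep : ProbabilityTheory.iIndepFun (fun (i : Fin n) (ω : ℕ → Ξ) => ω i.rev)
      (Measure.infinitePi fun _ : ℕ => ν) :=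
    .precomp (Fin.val_injective.comp Fin.rev_injective) <|
      ProbabilityTheory.iIndepFun_infinitePi (X := fun _ ξ => ξ) fun _ => measurable_id
  rw [(ProbabilityTheory.iIndepFun_iff_map_fun_eq_pi_map
    fun i => (measurable_pi_apply _).aemeasurable).1 hindep]
  congr! with i
  exact Measure.infinitePi_map_eval _ _

variable [Fintype Ξ] [MeasurableSpace Ξ] [DiscreteMeasurableSpace Ξ]

theorem integral_pi_uniformOfFintype [Nonempty Ξ] (n : ℕ) (F : (Fin n → Ξ) → ℝ) :
    ∫ ω, F ω ∂(Measure.pi fun _ : Fin n => (PMF.uniformOfFintype Ξ).toMeasure) =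
      ((Fintype.card Ξ : ℝ) ^ n)⁻¹ * ∑ ω, F ω := by
  rw [integral_fintype .of_finite, Finset.mul_sum]
  refine Finset.sum_congr rfl fun ω _ => ?_
  simp [measureReal_def, Measure.pi_singleton,
    PMF.toMeasure_apply_singleton _ _ (measurableSet_singleton _)]

theorem measurable_comp_rev {β : Type*} [MeasurableSpace β] (n : ℕ) (F : (Fin n → Ξ) → β) :
    Measurable fun ω : ℕ → Ξ => F fun i => ω i.rev :=
  (Measurable.of_discrete (f := F)).comp (measurable_pi_lambda _ fun _ => measurable_pi_apply _)

/-- Integrals against the law of the `n`-th SGD iterate in terms of backward iterates. -/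
theorem integral_sgdLaw_eq [Nonempty Ξ] (hg : ∀ ξ, Continuous (g ξ))
    (hmaps : ∀ ξ, ∀ x ∈ closedBall 0 R, x - η • g ξ x ∈ closedBall 0 R)
    {μ₀ : Measure (EuclideanSpace ℝ (Fin d))} [IsProbabilityMeasure μ₀]
    (hμ₀ : ∀ᵐ x ∂μ₀, x ∈ closedBall 0 R)
    {φ : EuclideanSpace ℝ (Fin d) → ℝ} (hφ : Continuous φ) (n : ℕ) :
    ∫ x, φ x ∂(sgdLaw g η μ₀ n) =
      ∫ ω, ∫ x, φ (backwardIter g η n ω x) ∂μ₀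
        ∂(Measure.infinitePi fun _ : ℕ => (PMF.uniformOfFintype Ξ).toMeasure) := by
  obtain ⟨M, hM⟩ := (isCompact_closedBall (0 : EuclideanSpace ℝ (Fin d)) R)
    |>.exists_bound_of_continuousOn hφ.continuousOn
  have hmeas (l : List Ξ) : AEMeasurable (sgdIter g η l) μ₀ :=
    (continuous_sgdIter hg l).measurable.aemeasurable
  have hint (l : List Ξ) : Integrable φ (μ₀.map (sgdIter g η l)) := by
    rw [integrable_map_measure hφ.aestronglyMeasurable (hmeas l)]
    refine .of_bound (hφ.comp (continuous_sgdIter hg l)).aestronglyMeasurable M ?_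
    filter_upwards [hμ₀] with x hx using hM _ (mapsTo_sgdIter hmaps l hx)
  have hword := integral_map (μ := Measure.infinitePi fun _ : ℕ =>
      (PMF.uniformOfFintype Ξ).toMeasure) (φ := fun ω (i : Fin n) => ω i.rev)
    (measurable_comp_rev n id).aemeasurable
    (f := fun w : Fin n → Ξ => ∫ x, φ (sgdIter g η (List.ofFn w) x) ∂μ₀)
    Measurable.of_discrete.aestronglyMeasurable
  simp only [backwardIter]
  rw [← hword, map_rev_infinitePi, integral_pi_uniformOfFintype, sgdLaw, integral_smul_measure,
    integral_finsetSum_measure fun w _ => hint _]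
  simp only [integral_map (hmeas _) hφ.aestronglyMeasurable]
  simp

/-- Random iteration of uniform contractions of a ball: the laws converge weakly, and at a
geometric rate on Lipschitz functions, to a law that does not depend on the initial one. -/
theorem exists_limit_sgdLaw [Nonempty Ξ] (hg : ∀ ξ, Continuous (g ξ)) (hR : 0 < R)
    (hmaps : ∀ ξ, ∀ x ∈ closedBall 0 R, x - η • g ξ x ∈ closedBall 0 R)
    (hρ : 0 ≤ ρ) (hρ1 : ρ < 1)
    (hcontr : ∀ ξ, ∀ x ∈ closedBall 0 R, ∀ y ∈ closedBall 0 R,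
      dist (x - η • g ξ x) (y - η • g ξ y) ≤ ρ * dist x y) :
    ∃ (π : Measure (EuclideanSpace ℝ (Fin d))) (C : ℝ), IsProbabilityMeasure π ∧ 0 < C ∧
      ∀ μ₀ : Measure (EuclideanSpace ℝ (Fin d)), IsProbabilityMeasure μ₀ →
        μ₀ (closedBall (0 : EuclideanSpace ℝ (Fin d)) R)ᶜ = 0 →
        (∀ φ : BoundedContinuousFunction (EuclideanSpace ℝ (Fin d)) ℝ,
          Tendsto (fun n => ∫ x, φ x ∂(sgdLaw g η μ₀ n)) atTop (nhds (∫ x, φ x ∂π))) ∧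
        (∀ (K : NNReal) (φ : EuclideanSpace ℝ (Fin d) → ℝ), LipschitzWith K φ → ∀ n : ℕ,
          |(∫ x, φ x ∂(sgdLaw g η μ₀ n)) - ∫ x, φ x ∂π| ≤ C * K * ρ ^ n) := by
  choose z hzR hz using exists_limit_backwardIter hR.le hmaps hρ hρ1 hcontr
  have hpow : Tendsto (fun n => 2 * R * ρ ^ n) atTop (nhds 0) := by
    simpa using (tendsto_pow_atTop_nhds_zero_of_lt_one hρ hρ1).const_mul (2 * R)
  have hlim (ω : ℕ → Ξ) {x : EuclideanSpace ℝ (Fin d)} (hx : x ∈ closedBall 0 R) :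
      Tendsto (fun n => backwardIter g η n ω x) atTop (nhds (z ω)) :=
    tendsto_iff_dist_tendsto_zero.2 <|
      squeeze_zero (fun _ => dist_nonneg) (fun n => hz ω n x hx) hpow
  have hzmeas : Measurable z := by
    refine measurable_of_tendsto_metrizable (f := fun n ω => backwardIter g η n ω 0)
      (fun n => measurable_comp_rev n fun w => sgdIter g η (List.ofFn w) 0) ?_
    exact tendsto_pi_nhds.2 fun ω => hlim ω (mem_closedBall_self hR.le)
  set P := Measure.infinitePi fun _ : ℕ => (PMF.uniformOfFintype Ξ).toMeasure
  refine ⟨P.map z, 2 * R, Measure.isProbabilityMeasure_map hzmeas.aemeasurable, by positivity,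
    fun μ₀ _ hμ₀ => ?_⟩
  have hμ₀' : ∀ᵐ x ∂μ₀, x ∈ closedBall 0 R := hμ₀
  refine ⟨fun φ => ?_, fun K φ hφ n => ?_⟩
  · simp only [integral_sgdLaw_eq hg hmaps hμ₀' φ.continuous]
    rw [integral_map hzmeas.aemeasurable φ.continuous.aestronglyMeasurable]
    refine tendsto_integral_of_dominated_convergence (fun _ => ‖φ‖) (fun n => ?_)
      (integrable_const _) (fun n => .of_forall fun ω => ?_) (.of_forall fun ω => ?_)
    · exact (measurable_comp_rev n fun w =>
        ∫ x, φ (sgdIter g η (List.ofFn w) x) ∂μ₀).aestronglyMeasurable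
    · simpa using norm_integral_le_of_norm_le_const (μ := μ₀)
        (.of_forall fun x => φ.norm_coe_le_norm (backwardIter g η n ω x))
    · have h := tendsto_integral_of_dominated_convergence (μ := μ₀)
        (F := fun n x => φ (backwardIter g η n ω x)) (f := fun _ => φ (z ω)) (fun _ => ‖φ‖)
        (fun n => (φ.continuous.comp (continuous_sgdIter hg _)).aestronglyMeasurable)
        (integrable_const _) (fun n => .of_forall fun x => φ.norm_coe_le_norm _)
        (hμ₀'.mono fun x hx => (φ.continuous.tendsto _).comp (hlim ω hx))
      simpa using h
  · obtain ⟨M, hM⟩ := (isCompact_closedBall (0 : EuclideanSpace ℝ (Fin d)) R)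
      |>.exists_bound_of_continuousOn hφ.continuous.continuousOn
    have hbdd (ω : ℕ → Ξ) : ∀ᵐ x ∂μ₀, ‖φ (backwardIter g η n ω x)‖ ≤ M :=
      hμ₀'.mono fun x hx => hM _ (mapsTo_sgdIter hmaps _ hx)
    have hinner (ω : ℕ → Ξ) : Integrable (fun x => φ (backwardIter g η n ω x)) μ₀ :=
      .of_bound (hφ.continuous.comp (continuous_sgdIter hg _)).aestronglyMeasurable M (hbdd ω)
    have houter : Integrable (fun ω => ∫ x, φ (backwardIter g η n ω x) ∂μ₀) P :=
      .of_bound (measurable_comp_rev n fun w =>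
        ∫ x, φ (sgdIter g η (List.ofFn w) x) ∂μ₀).aestronglyMeasurable M
        (.of_forall fun ω => by simpa using norm_integral_le_of_norm_le_const (hbdd ω))
    have hlimit : Integrable (fun ω => φ (z ω)) P :=
      .of_bound (hφ.continuous.measurable.comp hzmeas).aestronglyMeasurable M
        (.of_forall fun ω => hM _ (hzR ω))
    rw [integral_sgdLaw_eq hg hmaps hμ₀' hφ.continuous,
      integral_map hzmeas.aemeasurable hφ.continuous.aestronglyMeasurable,
      ← integral_sub houter hlimit, ← Real.norm_eq_abs]
    have hdiff (ω : ℕ → Ξ) :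
        ‖(∫ x, φ (backwardIter g η n ω x) ∂μ₀) - φ (z ω)‖ ≤ 2 * R * K * ρ ^ n := by
      have hsub : (∫ x, φ (backwardIter g η n ω x) ∂μ₀) - φ (z ω) =
          ∫ x, (φ (backwardIter g η n ω x) - φ (z ω)) ∂μ₀ := by
        rw [integral_sub (hinner ω) (integrable_const _)]
        simp
      rw [hsub]
      have hbound : ∀ᵐ x ∂μ₀, ‖φ (backwardIter g η n ω x) - φ (z ω)‖ ≤ 2 * R * K * ρ ^ n := by
        filter_upwards [hμ₀'] with x hx
        rw [← dist_eq_norm]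
        calc _ ≤ K * dist (backwardIter g η n ω x) (z ω) := hφ.dist_le_mul _ _
          _ ≤ K * (2 * R * ρ ^ n) := by gcongr; exact hz ω n x hx
          _ = _ := by ring
      simpa using norm_integral_le_of_norm_le_const hbound
    simpa using norm_integral_le_of_norm_le_const (μ := P) (.of_forall hdiff)

end RandomIteration

/-- A gradient step maps the ball of radius `R` into itself when the step size is small. -/
theorem norm_gradient_step_le {E : Type*} [NormedAddCommGroup E] [InnerProductSpace ℝ E]
    {γ b R η : ℝ} (hγ : 0 < γ) (hb : 0 < b) (hη : 0 < η)
    (hη₁ : η ≤ 1 / (2 * γ))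
    (hη₂ : η ≤ (3 * γ * R ^ 2 / 8 - 2 * b * R) / (2 * γ * b * R + b ^ 2))
    {x v v₀ : E} (hx : ‖x‖ ≤ R) (hv : ‖v‖ ≤ b + γ * ‖x‖) (hv₀ : ‖v₀‖ ≤ b)
    (hmono : γ * ‖x‖ ^ 2 ≤ inner ℝ x (v - v₀)) : ‖x - η • v‖ ≤ R := by
  have hx0 := norm_nonneg x
  have hR : 0 ≤ R := hx0.trans hx
  rw [le_div_iff₀ (by positivity)] at hη₁ hη₂
  have hinner : γ * ‖x‖ ^ 2 - b * ‖x‖ ≤ inner ℝ x v := by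
    have h := neg_le_of_abs_le (abs_real_inner_le_norm x v₀)
    rw [inner_sub_right] at hmono
    nlinarith
  have hsq : ‖x - η • v‖ ^ 2 = ‖x‖ ^ 2 - 2 * (η * inner ℝ x v) + η ^ 2 * ‖v‖ ^ 2 := by
    rw [norm_sub_sq_real, inner_smul_right, norm_smul, mul_pow, Real.norm_eq_abs, sq_abs]
  have hv2 : ‖v‖ ^ 2 ≤ (b + γ * ‖x‖) ^ 2 := by gcongr
  have hstep : ‖x - η • v‖ ^ 2 ≤
      (1 - η * γ) ^ 2 * ‖x‖ ^ 2 + 2 * η * b * (1 + η * γ) * ‖x‖ + η ^ 2 * b ^ 2 := by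
    rw [hsq]
    have h1 := mul_le_mul_of_nonneg_left hinner hη.le
    have h2 := mul_le_mul_of_nonneg_left hv2 (sq_nonneg η)
    nlinarith
  have hmonoR : (1 - η * γ) ^ 2 * ‖x‖ ^ 2 + 2 * η * b * (1 + η * γ) * ‖x‖ + η ^ 2 * b ^ 2 ≤
      (1 - η * γ) ^ 2 * R ^ 2 + 2 * η * b * (1 + η * γ) * R + η ^ 2 * b ^ 2 := by
    gcongr
  have hradius : (1 - η * γ) ^ 2 * R ^ 2 + 2 * η * b * (1 + η * γ) * R + η ^ 2 * b ^ 2 ≤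
      R ^ 2 := by
    have h1 : η * (η * (2 * γ * b * R + b ^ 2)) ≤ η * (3 * γ * R ^ 2 / 8 - 2 * b * R) := by
      gcongr
    have h2 : (η * (2 * γ)) * (η * γ * R ^ 2) ≤ 1 * (η * γ * R ^ 2) := by gcongr
    have h3 : 0 ≤ η * γ * R ^ 2 := by positivity
    nlinarith [mul_nonneg hη.le (mul_nonneg hb.le hR)]
  exact le_of_sq_le_sq (hstep.trans (hmonoR.trans hradius)) hR

/-- A small step along a strongly monotone Lipschitz field is a contraction. -/
theorem norm_sub_smul_le_of_strongly_monotone {E : Type*} [NormedAddCommGroup E]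
    [InnerProductSpace ℝ E] {γ L η : ℝ} (hη : 0 ≤ η) {u w : E} (hw : ‖w‖ ≤ L * ‖u‖)
    (hmono : γ * ‖u‖ ^ 2 ≤ inner ℝ u w) :
    ‖u - η • w‖ ≤ √(1 - 2 * γ * η + η ^ 2 * L ^ 2) * ‖u‖ := by
  have hsq : ‖u - η • w‖ ^ 2 ≤ (1 - 2 * γ * η + η ^ 2 * L ^ 2) * ‖u‖ ^ 2 := by
    rw [norm_sub_sq_real, inner_smul_right, norm_smul, mul_pow, Real.norm_eq_abs, sq_abs]
    have h1 := mul_le_mul_of_nonneg_left hmono hη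
    have h2 : η ^ 2 * ‖w‖ ^ 2 ≤ η ^ 2 * (L * ‖u‖) ^ 2 := by gcongr
    nlinarith
  rw [← Real.sqrt_sq (norm_nonneg u), ← Real.sqrt_mul' _ (sq_nonneg _)]
  exact Real.le_sqrt_of_sq_le hsq

/-- **Exponential convergence of the laws of SGD iterates to a stationary law `π`**
(Lemma `lmm:w2conv`): there is a probability measure `π`, independent of the initial law
`μ₀` (supported in `B(0,R)`), such that `μ_n → π` weakly, and for every `K`-Lipschitz test
function the error decays like `C·K·ρⁿ` with `ρ = (1 − 2γη + η²L²)^{1/2}`. -/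
theorem sgd_laws_converge_to_stationary_measure
    (d : ℕ) (hd : 1 ≤ d) (Ξ : Type) [Fintype Ξ] [Nonempty Ξ]
    (f : Ξ → EuclideanSpace ℝ (Fin d) → ℝ)
    (fbar : EuclideanSpace ℝ (Fin d) → ℝ)
    (hfbar : ∀ x, fbar x = (Fintype.card Ξ : ℝ)⁻¹ * ∑ ξ : Ξ, f ξ x)
    (γ b R₁ : ℝ) (hγ : 0 < γ) (hb : 0 < b) (hR₁pos : 0 < R₁)
    (hR₀R₁ : 16 * b / (3 * γ) < R₁)
    (hsmooth : ∀ ξ : Ξ, ContDiff ℝ 1 (f ξ))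
    (hconv : ∀ ξ : Ξ, ConvexOn ℝ (closedBall (0 : EuclideanSpace ℝ (Fin d)) R₁)
      (fun x => f ξ x - γ / 2 * ‖x‖ ^ 2))
    (hgrad0 : ∀ ξ : Ξ, ‖gradient (f ξ) (0 : EuclideanSpace ℝ (Fin d))‖ ≤ b)
    (hgradbd : ∀ ξ : Ξ, ∀ x ∈ closedBall (0 : EuclideanSpace ℝ (Fin d)) R₁,
      ‖gradient (f ξ) x‖ ≤ b + γ * ‖x‖)
    (R : ℝ) (hR₀R : 16 * b / (3 * γ) < R) (hRR₁ : R ≤ R₁)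
    (L : ℝ) (hL : 0 ≤ L)
    (hLip : ∀ ξ : Ξ, LipschitzOnWith (Real.toNNReal L) (fun x => gradient (f ξ) x)
      (closedBall (0 : EuclideanSpace ℝ (Fin d)) R))
    (η : ℝ) (hηpos : 0 < η)
    (hη : η ≤ min (1 / (2 * γ))
      (min (3 * R / (8 * b)) ((3 * γ * R ^ 2 / 8 - 2 * b * R) / (2 * γ * b * R + b ^ 2))))
    (hρpos : 0 < 1 - 2 * γ * η + η ^ 2 * L ^ 2)
    (hρlt : 1 - 2 * γ * η + η ^ 2 * L ^ 2 < 1) :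
    ∃ (π : Measure (EuclideanSpace ℝ (Fin d))) (C : ℝ),
      IsProbabilityMeasure π ∧ 0 < C ∧
      ∀ μ₀ : Measure (EuclideanSpace ℝ (Fin d)), IsProbabilityMeasure μ₀ →
        μ₀ (closedBall (0 : EuclideanSpace ℝ (Fin d)) R)ᶜ = 0 →
        -- weak convergence (convergence in distribution) of μ_n to π
        (∀ φ : BoundedContinuousFunction (EuclideanSpace ℝ (Fin d)) ℝ,
          Tendsto
            (fun n => ∫ x, φ x ∂ (sgdLaw (fun ξ x => gradient (f ξ) x) η μ₀ n))
            atTop (nhds (∫ x, φ x ∂ π))) ∧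
        -- quantitative rate against K-Lipschitz test functions
        (∀ (K : NNReal) (φ : EuclideanSpace ℝ (Fin d) → ℝ), LipschitzWith K φ →
          ∀ n : ℕ,
            |(∫ x, φ x ∂ (sgdLaw (fun ξ x => gradient (f ξ) x) η μ₀ n)) - ∫ x, φ x ∂ π| ≤
              C * K * (Real.sqrt (1 - 2 * γ * η + η ^ 2 * L ^ 2)) ^ n) := by
  have hRpos : 0 < R := (by positivity : 0 < 16 * b / (3 * γ)).trans hR₀R
  have hsub : closedBall (0 : EuclideanSpace ℝ (Fin d)) R ⊆ closedBall 0 R₁ :=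
    closedBall_subset_closedBall hRR₁
  have hdiff (ξ : Ξ) : Differentiable ℝ (f ξ) := (hsmooth ξ).differentiable one_ne_zero
  have hmono (ξ : Ξ) {x y : EuclideanSpace ℝ (Fin d)} (hx : x ∈ closedBall 0 R)
      (hy : y ∈ closedBall 0 R) :=
    strongly_monotone_gradient (hdiff ξ) (hconv ξ) (hsub hx) (hsub hy)
  let _ : MeasurableSpace Ξ := ⊤
  refine exists_limit_sgdLaw (fun ξ => ?_) hRpos (fun ξ x hx => ?_) (Real.sqrt_nonneg _)
    ((Real.sqrt_lt' one_pos).2 (by simpa using hρlt)) fun ξ x hx y hy => ?_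
  · exact (InnerProductSpace.toDual ℝ _).symm.continuous.comp
      ((hsmooth ξ).continuous_fderiv one_ne_zero)
  · rw [mem_closedBall_zero_iff]
    exact norm_gradient_step_le hγ hb hηpos (hη.trans (min_le_left _ _))
      (hη.trans ((min_le_right _ _).trans (min_le_right _ _)))
      (mem_closedBall_zero_iff.1 hx) (hgradbd ξ x (hsub hx)) (hgrad0 ξ)
      (by simpa using hmono ξ hx (mem_closedBall_self hRpos.le))
  · have hLxy := (hLip ξ).dist_le_mul x hx y hy
    rw [Real.coe_toNNReal L hL, dist_eq_norm, dist_eq_norm] at hLxy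
    rw [dist_eq_norm, dist_eq_norm, sub_sub_sub_comm, ← smul_sub]
    exact norm_sub_smul_le_of_strongly_monotone hηpos.le hLxy (hmono ξ hx hy)
end

section
/- Let f : ℝ^d → ℝ be continuously differentiable, γ-strongly convex on the closed ball B(0,R) for some γ > 0, R > 0, with ∇f(0) = 0. If y : [0,∞) → ℝ^d solves the gradient flow y'(t) = −∇f(y(t)) with y(0) = x ∈ B(0,R), then y(t) ∈ B(0,R) for all t ≥ 0, the function t ↦ ‖y(t)‖ is non-increasing, and ‖y(t)‖ ≤ ‖x‖ e^{−γt} for all t ≥ 0. -/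
open Metric Set

section GradientFlow

variable {E : Type*} [NormedAddCommGroup E] [InnerProductSpace ℝ E]

/-- The gradient of a function that is `γ`-strongly convex on a convex set containing its critical
point `0` is `γ`-coercive on that set. -/
theorem mul_norm_sq_le_inner_gradient_of_convexOn [CompleteSpace E] {f : E → ℝ} {γ : ℝ} {S : Set E}
    (hconv : ConvexOn ℝ S (fun x => f x - γ / 2 * ‖x‖ ^ 2)) (h0S : (0 : E) ∈ S)
    (hf0 : DifferentiableAt ℝ f 0) (hgrad0 : gradient f 0 = 0)
    {z : E} (hz : z ∈ S) (hfz : DifferentiableAt ℝ f z) :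
    γ * ‖z‖ ^ 2 ≤ inner ℝ (gradient f z) z := by
  have hderiv (s : ℝ) (hs : DifferentiableAt ℝ f (s • z)) :
      HasDerivAt (fun s : ℝ => f (s • z) - γ / 2 * ‖s • z‖ ^ 2)
        (inner ℝ (gradient f (s • z)) z - γ * inner ℝ (s • z) z) s := by
    have hline : HasDerivAt (fun s : ℝ => s • z) z s := by
      simpa using (hasDerivAt_id s).smul_const z
    have hcomp := hs.hasFDerivAt.comp_hasDerivAt s hline
    rw [← inner_gradient_left] at hcomp
    refine (hcomp.sub (hline.norm_sq.const_mul (γ / 2))).congr_deriv ?_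
    ring
  have hline_conv : ConvexOn ℝ (Icc 0 1) (fun s : ℝ => f (s • z) - γ / 2 * ‖s • z‖ ^ 2) :=
    (hconv.comp_linearMap (LinearMap.toSpanSingleton ℝ E z)).subset
      (fun s hs => hconv.1.smul_mem_of_zero_mem h0S hz hs) (convex_Icc 0 1)
  have h0 : (0 : ℝ) ∈ Icc (0 : ℝ) 1 := left_mem_Icc.2 zero_le_one
  have h1 : (1 : ℝ) ∈ Icc (0 : ℝ) 1 := right_mem_Icc.2 zero_le_one
  have hslope := (hline_conv.le_slope_of_hasDerivAt h0 h1 zero_lt_one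
    (hderiv 0 (by simpa using hf0))).trans
    (hline_conv.slope_le_of_hasDerivAt h0 h1 zero_lt_one (hderiv 1 (by simpa using hfz)))
  simpa [hgrad0] using hslope

/-- A curve whose velocity points strictly inwards on the sphere of radius `R` does not leave the
closed ball of radius `R`. -/
theorem mem_closedBall_of_inner_deriv_neg {y y' : ℝ → E} {R : ℝ}
    (hy : ∀ t ≥ (0 : ℝ), HasDerivAt y (y' t) t) (hy0 : y 0 ∈ closedBall (0 : E) R)
    (hneg : ∀ t ≥ (0 : ℝ), ‖y t‖ = R → inner ℝ (y t) (y' t) < 0) {t : ℝ} (ht : 0 ≤ t) :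
    y t ∈ closedBall (0 : E) R := by
  rw [mem_closedBall_zero_iff] at hy0 ⊢
  have hR : 0 ≤ R := (norm_nonneg _).trans hy0
  have hsq (s : ℝ) (hs : 0 ≤ s) := (hy s hs).norm_sq
  have hle : ‖y t‖ ^ 2 ≤ R ^ 2 :=
    image_le_of_deriv_right_lt_deriv_boundary (f := fun s => ‖y s‖ ^ 2) (B := fun _ => R ^ 2)
      (B' := fun _ => 0) (a := 0) (b := t)
      (fun s hs => (hsq s hs.1).continuousAt.continuousWithinAt)
      (fun s hs => (hsq s hs.1).hasDerivWithinAt)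
      (pow_le_pow_left₀ (norm_nonneg _) hy0 2) (fun s => hasDerivAt_const s _)
      (fun s hs h => by
        have := hneg s hs.1 ((pow_left_inj₀ (norm_nonneg _) hR two_ne_zero).1 h)
        linarith)
      (right_mem_Icc.2 ht)
  exact (pow_le_pow_iff_left₀ (norm_nonneg _) hR two_ne_zero).1 hle

/-- Grönwall-type decay: if `⟪y, y'⟫ ≤ -γ ‖y‖ ^ 2` along a curve, then `e^{γt} ‖y t‖` is
non-increasing. -/
theorem antitoneOn_exp_mul_norm_of_inner_deriv_le {y y' : ℝ → E} {γ : ℝ}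
    (hy : ∀ t ≥ (0 : ℝ), HasDerivAt y (y' t) t)
    (hdecay : ∀ t ≥ (0 : ℝ), inner ℝ (y t) (y' t) ≤ -γ * ‖y t‖ ^ 2) :
    AntitoneOn (fun t => Real.exp (γ * t) * ‖y t‖) (Ici (0 : ℝ)) := by
  have hderiv (t : ℝ) (ht : 0 ≤ t) : HasDerivAt (fun t => Real.exp (2 * γ * t) * ‖y t‖ ^ 2)
      (2 * Real.exp (2 * γ * t) * (γ * ‖y t‖ ^ 2 + inner ℝ (y t) (y' t))) t := by
    have hexp := ((hasDerivAt_id t).const_mul (2 * γ)).exp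
    refine (hexp.mul (hy t ht).norm_sq).congr_deriv ?_
    simp only [id]
    ring
  have hsq : AntitoneOn (fun t => Real.exp (2 * γ * t) * ‖y t‖ ^ 2) (Ici (0 : ℝ)) := by
    refine antitoneOn_of_deriv_nonpos (convex_Ici 0)
      (fun t ht => (hderiv t ht).continuousAt.continuousWithinAt)
      (fun t ht => (hderiv t (interior_subset ht)).differentiableAt.differentiableWithinAt)
      (fun t ht => ?_)
    rw [(hderiv t (interior_subset ht)).deriv]
    have := hdecay t (interior_subset ht)
    exact mul_nonpos_of_nonneg_of_nonpos (by positivity) (by linarith)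
  intro s hs t ht hst
  refine (pow_le_pow_iff_left₀ (by positivity) (by positivity) two_ne_zero).1 ?_
  have hexp_sq (r : ℝ) : Real.exp (γ * r) ^ 2 = Real.exp (2 * γ * r) := by
    rw [← Real.exp_nat_mul]
    ring_nf
  simpa only [mul_pow, hexp_sq] using hsq hs ht hst

end GradientFlow

/-- **Confinement and exponential decay of the gradient flow** of a locally strongly convex
function with `∇f(0) = 0`: solutions started in `B(0,R)` stay in `B(0,R)`, have
non-increasing norm, and satisfy `‖y(t)‖ ≤ ‖x‖ e^{−γt}`. -/
theorem gradientFlow_ball_invariant_norm_decay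
    (d : ℕ) (hd : 1 ≤ d)
    (f : EuclideanSpace ℝ (Fin d) → ℝ)
    (γ R : ℝ) (hγ : 0 < γ) (hR : 0 < R)
    (hsmooth : ContDiff ℝ 1 f)
    (hconv : ConvexOn ℝ (closedBall (0 : EuclideanSpace ℝ (Fin d)) R)
      (fun x => f x - γ / 2 * ‖x‖ ^ 2))
    (hgrad0 : gradient f (0 : EuclideanSpace ℝ (Fin d)) = 0)
    (x : EuclideanSpace ℝ (Fin d)) (hx : x ∈ closedBall (0 : EuclideanSpace ℝ (Fin d)) R)
    (y : ℝ → EuclideanSpace ℝ (Fin d))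
    (hy0 : y 0 = x)
    (hyflow : ∀ t ≥ (0 : ℝ), HasDerivAt y (-gradient f (y t)) t) :
    (∀ t ≥ (0 : ℝ), y t ∈ closedBall (0 : EuclideanSpace ℝ (Fin d)) R) ∧
    (AntitoneOn (fun t => ‖y t‖) (Ici (0 : ℝ))) ∧
    (∀ t ≥ (0 : ℝ), ‖y t‖ ≤ ‖x‖ * Real.exp (-γ * t)) := by
  have hdiff : Differentiable ℝ f := hsmooth.differentiable one_ne_zero
  have hcoercive {z : EuclideanSpace ℝ (Fin d)} (hz : z ∈ closedBall 0 R) :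
      inner ℝ z (-gradient f z) ≤ -γ * ‖z‖ ^ 2 := by
    have := mul_norm_sq_le_inner_gradient_of_convexOn hconv (mem_closedBall_self hR.le)
      (hdiff 0) hgrad0 hz (hdiff z)
    rw [inner_neg_right, real_inner_comm]
    linarith
  have hball : ∀ t ≥ (0 : ℝ), y t ∈ closedBall 0 R := fun t ht =>
    mem_closedBall_of_inner_deriv_neg hyflow (hy0 ▸ hx) (fun s _ hsR => by
      have := hcoercive (mem_closedBall_zero_iff.2 hsR.le)
      rw [hsR] at this
      nlinarith [mul_pos hγ (pow_pos hR 2)]) ht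
  have hanti := antitoneOn_exp_mul_norm_of_inner_deriv_le hyflow
    (fun t ht => hcoercive (hball t ht))
  refine ⟨hball, fun s hs t ht hst => ?_, fun t ht => ?_⟩
  · have hexp : Real.exp (γ * s) ≤ Real.exp (γ * t) := by gcongr
    exact le_of_mul_le_mul_left
      ((mul_le_mul_of_nonneg_right hexp (norm_nonneg _)).trans (hanti hs ht hst))
      (Real.exp_pos _)
  · have h := hanti self_mem_Ici ht ht
    simp only [mul_zero, Real.exp_zero, one_mul, hy0] at h
    rwa [neg_mul, Real.exp_neg, ← div_eq_mul_inv, le_div_iff₀ (Real.exp_pos _), mul_comm]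
end

section
/- Let f : ℝ^d → ℝ be continuously differentiable, γ-strongly convex on the closed ball B(0,R), with ∇f(0) = 0, and for x ∈ B(0,R) let y_x denote the solution of the gradient flow y'(t) = −∇f(y(t)), y(0) = x. Let φ : ℝ^d → ℝ be continuously differentiable and define u₀(x,t) := φ(y_x(t)). Then for all x ∈ B(0,R) and t ≥ 0, |u₀(x,t) − φ(0)| ≤ R ‖φ‖_{C¹(B(0,R))} e^{−γt}, where ‖φ‖_{C¹(B(0,R))} := sup_{B(0,R)} |φ| + sup_{B(0,R)} ‖∇φ‖. -/
open Metric Set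

section GradientFlow

variable {E : Type*} [NormedAddCommGroup E] [InnerProductSpace ℝ E]

/-- Strong monotonicity of the gradient of a strongly convex function, tested against a critical
point at the origin. -/
theorem mul_sq_norm_le_inner_gradient [CompleteSpace E] {f : E → ℝ} {γ : ℝ} {s : Set E}
    (hf : Differentiable ℝ f) (hconv : ConvexOn ℝ s (fun x => f x - γ / 2 * ‖x‖ ^ 2))
    (hgrad0 : gradient f 0 = 0) (h0 : (0 : E) ∈ s) {x : E} (hx : x ∈ s) :
    γ * ‖x‖ ^ 2 ≤ inner ℝ (gradient f x) x := by
  set L : ℝ →ᵃ[ℝ] E := AffineMap.lineMap 0 x with hL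
  have hLs : ∀ r, L r = r • x := fun r => by simp [hL, AffineMap.lineMap_apply]
  have hsub : Icc (0 : ℝ) 1 ⊆ L ⁻¹' s := fun r hr => by
    have := hconv.1.segment_subset h0 hx
    rw [segment_eq_image_lineMap] at this
    exact this ⟨r, hr, rfl⟩
  have hline := (hconv.comp_affineMap L).subset hsub (convex_Icc 0 1)
  have hderiv : ∀ r : ℝ, HasDerivAt ((fun x => f x - γ / 2 * ‖x‖ ^ 2) ∘ L)
      (inner ℝ (gradient f (r • x)) x - γ * r * ‖x‖ ^ 2) r := fun r => by
    have hs : HasDerivAt (fun r : ℝ => r • x) x r := by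
      simpa using (hasDerivAt_id r).smul_const x
    have h1 := (hf (r • x)).hasGradientAt.hasFDerivAt.comp_hasDerivAt r hs
    have h2 : HasDerivAt (fun r : ℝ => γ / 2 * (r ^ 2 * ‖x‖ ^ 2)) (γ * r * ‖x‖ ^ 2) r := by
      refine (((hasDerivAt_pow 2 r).mul_const (‖x‖ ^ 2)).const_mul (γ / 2)).congr_deriv ?_
      push_cast
      ring
    have hcomp : (fun x => f x - γ / 2 * ‖x‖ ^ 2) ∘ L =
        (f ∘ fun r => r • x) - fun r => γ / 2 * (r ^ 2 * ‖x‖ ^ 2) := by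
      funext r
      simp [hLs, norm_smul, mul_pow]
    rw [hcomp]
    exact (h1.sub h2).congr_deriv (by simp)
  have hleft := hline.le_slope_of_hasDerivAt (left_mem_Icc.2 zero_le_one)
    (right_mem_Icc.2 zero_le_one) one_pos (hderiv 0)
  have hright := hline.slope_le_of_hasDerivAt (left_mem_Icc.2 zero_le_one)
    (right_mem_Icc.2 zero_le_one) one_pos (hderiv 1)
  have := hleft.trans hright
  simp only [zero_smul, one_smul, hgrad0, inner_zero_left, mul_zero, zero_mul, mul_one,
    sub_zero] at this
  linarith

/-- A curve starting in the ball of radius `R` whose velocity field `-v` is strongly inward on that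
ball contracts exponentially. -/
theorem norm_le_mul_exp_of_inward {v : E → E} {γ R : ℝ} (hγ : 0 < γ) (hR : 0 < R)
    (hv : ∀ x ∈ closedBall (0 : E) R, γ * ‖x‖ ^ 2 ≤ inner ℝ (v x) x) {y : ℝ → E}
    (hy0 : y 0 ∈ closedBall (0 : E) R) (hy : ∀ t ≥ (0 : ℝ), HasDerivAt y (-v (y t)) t)
    {t : ℝ} (ht : 0 ≤ t) : ‖y t‖ ≤ R * Real.exp (-γ * t) := by
  have hslow : ∀ c ∈ Ioo 0 γ, ‖y t‖ ^ 2 ≤ R ^ 2 * Real.exp (-(2 * c) * t) := by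
    intro c hc
    have hn : ∀ r ≥ (0 : ℝ), HasDerivAt (fun r => ‖y r‖ ^ 2) (2 * inner ℝ (y r) (-v (y r))) r :=
      fun r hr => (hy r hr).norm_sq
    have hB : ∀ r : ℝ, HasDerivAt (fun r => R ^ 2 * Real.exp (-(2 * c) * r))
        (-(2 * c) * (R ^ 2 * Real.exp (-(2 * c) * r))) r := fun r => by
      refine ((((hasDerivAt_id r).const_mul (-(2 * c))).exp).const_mul (R ^ 2)).congr_deriv ?_
      simp only [id_eq]
      ring
    refine image_le_of_deriv_right_lt_deriv_boundary
      (fun r hr => (hn r hr.1).continuousAt.continuousWithinAt)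
      (fun r hr => (hn r hr.1).hasDerivWithinAt) ?_ hB ?_ (right_mem_Icc.2 ht)
    · have := mem_closedBall_zero_iff.1 hy0
      simpa using pow_le_pow_left₀ (norm_nonneg _) this 2
    · intro r hr heq
      have hexp : Real.exp (-(2 * c) * r) ≤ 1 :=
        Real.exp_le_one_iff.2 (by nlinarith [mul_nonneg hc.1.le hr.1])
      have hmem : y r ∈ closedBall (0 : E) R := by
        rw [mem_closedBall_zero_iff]
        refine le_of_sq_le_sq ?_ hR.le
        rw [heq]
        exact mul_le_of_le_one_right (sq_nonneg R) hexp
      have hpos : 0 < ‖y r‖ ^ 2 := by rw [heq]; positivity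
      rw [← heq, inner_neg_right, real_inner_comm]
      nlinarith [hv _ hmem, mul_pos (sub_pos.2 hc.2) hpos]
  have hlim : ‖y t‖ ^ 2 ≤ R ^ 2 * Real.exp (-(2 * γ) * t) := by
    have hcont : Continuous fun c : ℝ => R ^ 2 * Real.exp (-(2 * c) * t) := by fun_prop
    refine ge_of_tendsto (hcont.continuousWithinAt (s := Iio γ) (x := γ)) ?_
    filter_upwards [Ioo_mem_nhdsLT hγ] with c hc using hslow c hc
  refine le_of_sq_le_sq ?_ (by positivity)
  rwa [mul_pow, ← Real.exp_nat_mul, show ((2 : ℕ) : ℝ) * (-γ * t) = -(2 * γ) * t by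
    push_cast; ring]

/-- A `C¹` function on a ball is Lipschitz at the center with constant the supremum of the norm of
its gradient. -/
theorem abs_sub_le_sSup_norm_gradient_mul [CompleteSpace E] [ProperSpace E] {φ : E → ℝ}
    (hφ : ContDiff ℝ 1 φ) {R : ℝ} (hR : 0 ≤ R) {x : E} (hx : x ∈ closedBall (0 : E) R) :
    |φ x - φ 0| ≤ sSup ((fun z => ‖gradient φ z‖) '' closedBall (0 : E) R) * ‖x‖ := by
  have hnorm : ∀ z, ‖gradient φ z‖ = ‖fderiv ℝ φ z‖ := fun z => by simp [gradient]
  have hbdd : BddAbove ((fun z => ‖gradient φ z‖) '' closedBall (0 : E) R) := by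
    simp only [hnorm]
    exact (isCompact_closedBall 0 R).bddAbove_image
      (hφ.continuous_fderiv one_ne_zero).norm.continuousOn
  have := (convex_closedBall (0 : E) R).norm_image_sub_le_of_norm_fderiv_le
    (fun z _ => hφ.differentiable one_ne_zero z)
    (fun z hz => (hnorm z).symm.le.trans (le_csSup hbdd (mem_image_of_mem _ hz)))
    (mem_closedBall_self hR) hx
  simpa using this

end GradientFlow

/-- **Exponential convergence of the zeroth-order coefficient `u₀(x,t) = φ(y_x(t))`**
(Theorem `p:main` (i), first part): along the gradient flow of a locally strongly convex
`f` with `∇f(0) = 0`, `|u₀(x,t) − φ(0)| ≤ R ‖φ‖_{C¹(B(0,R))} e^{−γt}`, where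
`‖φ‖_{C¹(B(0,R))} = sup_{B(0,R)}|φ| + sup_{B(0,R)}‖∇φ‖`. -/
theorem u0_exponential_decay
    (d : ℕ) (hd : 1 ≤ d)
    (f : EuclideanSpace ℝ (Fin d) → ℝ)
    (γ R : ℝ) (hγ : 0 < γ) (hR : 0 < R)
    (hsmooth : ContDiff ℝ 1 f)
    (hconv : ConvexOn ℝ (closedBall (0 : EuclideanSpace ℝ (Fin d)) R)
      (fun x => f x - γ / 2 * ‖x‖ ^ 2))
    (hgrad0 : gradient f (0 : EuclideanSpace ℝ (Fin d)) = 0)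
    (y : EuclideanSpace ℝ (Fin d) → ℝ → EuclideanSpace ℝ (Fin d))
    (hy0 : ∀ x ∈ closedBall (0 : EuclideanSpace ℝ (Fin d)) R, y x 0 = x)
    (hyflow : ∀ x ∈ closedBall (0 : EuclideanSpace ℝ (Fin d)) R,
      ∀ t ≥ (0 : ℝ), HasDerivAt (y x) (-gradient f (y x t)) t)
    (φ : EuclideanSpace ℝ (Fin d) → ℝ) (hφ : ContDiff ℝ 1 φ) :
    ∀ x ∈ closedBall (0 : EuclideanSpace ℝ (Fin d)) R, ∀ t ≥ (0 : ℝ),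
      |φ (y x t) - φ 0| ≤
        R * (sSup ((fun z => |φ z|) '' closedBall (0 : EuclideanSpace ℝ (Fin d)) R) +
              sSup ((fun z => ‖gradient φ z‖) '' closedBall (0 : EuclideanSpace ℝ (Fin d)) R)) *
          Real.exp (-γ * t) := by
  intro x hx t ht
  have hdecay : ‖y x t‖ ≤ R * Real.exp (-γ * t) :=
    norm_le_mul_exp_of_inward hγ hR
      (fun z hz => mul_sq_norm_le_inner_gradient (hsmooth.differentiable one_ne_zero) hconv hgrad0
        (mem_closedBall_self hR.le) hz)
      ((hy0 x hx).symm ▸ hx) (hyflow x hx) ht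
  have hmem : y x t ∈ closedBall (0 : EuclideanSpace ℝ (Fin d)) R :=
    mem_closedBall_zero_iff.2 (hdecay.trans (mul_le_of_le_one_right hR.le
      (Real.exp_le_one_iff.2 (by nlinarith [mul_nonneg hγ.le ht]))))
  have hlip := abs_sub_le_sSup_norm_gradient_mul hφ hR.le hmem
  set S := sSup ((fun z => |φ z|) '' closedBall (0 : EuclideanSpace ℝ (Fin d)) R)
  set M := sSup ((fun z => ‖gradient φ z‖) '' closedBall (0 : EuclideanSpace ℝ (Fin d)) R)
  have hS : 0 ≤ S := Real.sSup_nonneg (by rintro _ ⟨z, -, rfl⟩; exact abs_nonneg _)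
  have hM : 0 ≤ M := Real.sSup_nonneg (by rintro _ ⟨z, -, rfl⟩; exact norm_nonneg _)
  calc |φ (y x t) - φ 0| ≤ M * ‖y x t‖ := hlip
    _ ≤ (S + M) * (R * Real.exp (-γ * t)) := by
      gcongr
      linarith
    _ = R * (S + M) * Real.exp (-γ * t) := by ring
end

section
/- Let f : ℝ^d → ℝ be continuously differentiable, γ-strongly convex on the closed ball B(0,R), with ∇f(0) = 0, and for x ∈ B(0,R) let y_x denote the solution of the gradient flow y'(t) = −∇f(y(t)), y(0) = x. Let φ : ℝ^d → ℝ be continuously differentiable and define u₀(x,t) := φ(y_x(t)). Then for each t ≥ 0 the map x ↦ u₀(x,t) is (‖φ‖_{C¹(B(0,R))} e^{−γt})-Lipschitz on B(0,R): for all x, z ∈ B(0,R), |u₀(x,t) − u₀(z,t)| ≤ ‖φ‖_{C¹(B(0,R))} e^{−γt} ‖x − z‖. -/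
open Metric Set

section GradientFlow

variable {E : Type*} [NormedAddCommGroup E] [InnerProductSpace ℝ E]

theorem ConvexOn.inner_sub_nonneg_of_hasGradientAt [CompleteSpace E] {s : Set E} {F : E → ℝ}
    (hF : ConvexOn ℝ s F) {a b ga gb : E} (ha : a ∈ s) (hb : b ∈ s)
    (hga : HasGradientAt F ga a) (hgb : HasGradientAt F gb b) :
    0 ≤ inner ℝ (ga - gb) (a - b) := by
  have hconv := hF.comp_affineMap (AffineMap.lineMap a b : ℝ →ᵃ[ℝ] E)
  have h0 : HasDerivAt (F ∘ (AffineMap.lineMap a b : ℝ →ᵃ[ℝ] E)) (inner ℝ ga (b - a)) 0 := by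
    have hl : HasFDerivAt F (InnerProductSpace.toDual ℝ E ga)
        ((AffineMap.lineMap a b : ℝ →ᵃ[ℝ] E) 0) := by
      simpa using hga.hasFDerivAt
    simpa using hl.comp_hasDerivAt (0 : ℝ) AffineMap.hasDerivAt_lineMap
  have h1 : HasDerivAt (F ∘ (AffineMap.lineMap a b : ℝ →ᵃ[ℝ] E)) (inner ℝ gb (b - a)) 1 := by
    have hl : HasFDerivAt F (InnerProductSpace.toDual ℝ E gb)
        ((AffineMap.lineMap a b : ℝ →ᵃ[ℝ] E) 1) := by
      simpa using hgb.hasFDerivAt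
    simpa using hl.comp_hasDerivAt (1 : ℝ) AffineMap.hasDerivAt_lineMap
  have m0 : (0 : ℝ) ∈ (AffineMap.lineMap a b : ℝ →ᵃ[ℝ] E) ⁻¹' s := by simpa using ha
  have m1 : (1 : ℝ) ∈ (AffineMap.lineMap a b : ℝ →ᵃ[ℝ] E) ⁻¹' s := by simpa using hb
  have hle := (hconv.le_slope_of_hasDerivAt m0 m1 zero_lt_one h0).trans
    (hconv.slope_le_of_hasDerivAt m0 m1 zero_lt_one h1)
  rw [← neg_sub b a, inner_neg_right, inner_sub_left]
  linarith

theorem ConvexOn.mul_norm_sq_le_inner_gradient_sub [CompleteSpace E] {s : Set E} {f : E → ℝ}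
    {γ : ℝ} (hf : ConvexOn ℝ s fun x => f x - γ / 2 * ‖x‖ ^ 2) (hd : Differentiable ℝ f)
    {a b : E} (ha : a ∈ s) (hb : b ∈ s) :
    γ * ‖a - b‖ ^ 2 ≤ inner ℝ (gradient f a - gradient f b) (a - b) := by
  have hgrad (x : E) :
      HasGradientAt (fun x => f x - γ / 2 * ‖x‖ ^ 2) (gradient f x - γ • x) x := by
    rw [hasGradientAt_iff_hasFDerivAt]
    have h := (hd x).hasGradientAt.hasFDerivAt.sub
      (((hasStrictFDerivAt_norm_sq x).hasFDerivAt).const_mul (γ / 2))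
    refine h.congr_fderiv ?_
    ext v
    simp
    ring
  have h := hf.inner_sub_nonneg_of_hasGradientAt ha hb (hgrad a) (hgrad b)
  have e : gradient f a - γ • a - (gradient f b - γ • b)
      = (gradient f a - gradient f b) - γ • (a - b) := by
    rw [smul_sub]; abel
  rw [e, inner_sub_left, real_inner_smul_left, real_inner_self_eq_norm_sq] at h
  linarith

theorem norm_le_of_hasDerivAt_neg {v : E → E} {R : ℝ} (hR : 0 ≤ R)
    (hv : ∀ a, ‖a‖ = R → 0 < inner ℝ (v a) a) {u : ℝ → E} (h0 : ‖u 0‖ ≤ R)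
    (hu : ∀ t ≥ (0 : ℝ), HasDerivAt u (-v (u t)) t) {t : ℝ} (ht : 0 ≤ t) : ‖u t‖ ≤ R := by
  have hderiv (s : ℝ) (hs : 0 ≤ s) :
      HasDerivAt (fun s => ‖u s‖ ^ 2) (2 * inner ℝ (u s) (-v (u s))) s := (hu s hs).norm_sq
  have h := image_le_of_deriv_right_lt_deriv_boundary (a := 0) (b := t)
    (f := fun s => ‖u s‖ ^ 2) (B := fun _ => R ^ 2) (B' := fun _ => 0)
    (fun s hs => (hderiv s hs.1).continuousAt.continuousWithinAt)
    (fun s hs => (hderiv s hs.1).hasDerivWithinAt)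
    (pow_le_pow_left₀ (norm_nonneg _) h0 2)
    (fun s => hasDerivAt_const s _)
    (fun s _ hs => by
      have := hv (u s) ((sq_eq_sq₀ (norm_nonneg _) hR).1 hs)
      rw [inner_neg_right, real_inner_comm]
      linarith)
    (right_mem_Icc.2 ht)
  exact (sq_le_sq₀ (norm_nonneg _) hR).1 h

theorem norm_sub_le_exp_mul_of_hasDerivAt_neg {v : E → E} {s : Set E} {γ : ℝ}
    (hv : ∀ a ∈ s, ∀ b ∈ s, γ * ‖a - b‖ ^ 2 ≤ inner ℝ (v a - v b) (a - b)) {u w : ℝ → E}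
    (hus : ∀ t ≥ (0 : ℝ), u t ∈ s) (hws : ∀ t ≥ (0 : ℝ), w t ∈ s)
    (hu : ∀ t ≥ (0 : ℝ), HasDerivAt u (-v (u t)) t)
    (hw : ∀ t ≥ (0 : ℝ), HasDerivAt w (-v (w t)) t) {t : ℝ} (ht : 0 ≤ t) :
    ‖u t - w t‖ ≤ Real.exp (-γ * t) * ‖u 0 - w 0‖ := by
  have hderiv (r : ℝ) (hr : 0 ≤ r) :
      HasDerivAt (fun r => Real.exp (2 * γ * r) * ‖u r - w r‖ ^ 2)
        (Real.exp (2 * γ * r) * (2 * γ) * ‖u r - w r‖ ^ 2 + Real.exp (2 * γ * r) *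
          (2 * inner ℝ (u r - w r) (-v (u r) - -v (w r)))) r := by
    have he : HasDerivAt (fun r => Real.exp (2 * γ * r)) (Real.exp (2 * γ * r) * (2 * γ)) r := by
      simpa using ((hasDerivAt_id r).const_mul (2 * γ)).exp
    exact he.mul ((hu r hr).sub (hw r hr)).norm_sq
  have hanti : AntitoneOn (fun r => Real.exp (2 * γ * r) * ‖u r - w r‖ ^ 2) (Ici 0) := by
    refine antitoneOn_of_deriv_nonpos (convex_Ici 0)
      (fun r hr => (hderiv r hr).continuousAt.continuousWithinAt)
      (fun r hr => (hderiv r (interior_subset hr)).differentiableAt.differentiableWithinAt)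
      fun r hr => ?_
    have hr0 : 0 ≤ r := interior_subset hr
    rw [(hderiv r hr0).deriv]
    have h := mul_le_mul_of_nonneg_left (hv _ (hus r hr0) _ (hws r hr0))
      (Real.exp_pos (2 * γ * r)).le
    have e : -v (u r) - -v (w r) = -(v (u r) - v (w r)) := by abel
    rw [e, inner_neg_right, real_inner_comm]
    linarith
  have h := hanti (mem_Ici.2 le_rfl) (mem_Ici.2 ht) ht
  simp only [mul_zero, Real.exp_zero, one_mul] at h
  refine (sq_le_sq₀ (norm_nonneg _) (by positivity)).1 ?_
  have hexp : Real.exp (-γ * t) ^ 2 * Real.exp (2 * γ * t) = 1 := by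
    rw [← Real.exp_nat_mul, ← Real.exp_add, Real.exp_eq_one_iff]
    push_cast
    ring
  calc ‖u t - w t‖ ^ 2
      = Real.exp (-γ * t) ^ 2 * (Real.exp (2 * γ * t) * ‖u t - w t‖ ^ 2) := by
        rw [← mul_assoc, hexp, one_mul]
    _ ≤ Real.exp (-γ * t) ^ 2 * ‖u 0 - w 0‖ ^ 2 := by gcongr
    _ = _ := by rw [mul_pow]

theorem norm_gradient_eq_norm_fderiv [CompleteSpace E] (φ : E → ℝ) (x : E) :
    ‖gradient φ x‖ = ‖fderiv ℝ φ x‖ := by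
  rw [← toDual_gradient, LinearIsometryEquiv.norm_map]

theorem abs_sub_le_sSup_norm_gradient_mul_s7 [CompleteSpace E] {s : Set E} (hs : Convex ℝ s)
    (hc : IsCompact s) {φ : E → ℝ} (hφ : ContDiff ℝ 1 φ) {a b : E} (ha : a ∈ s) (hb : b ∈ s) :
    |φ a - φ b| ≤ sSup ((fun w => ‖gradient φ w‖) '' s) * ‖a - b‖ := by
  have hbdd : BddAbove ((fun w => ‖gradient φ w‖) '' s) := by
    simp only [norm_gradient_eq_norm_fderiv]
    exact hc.bddAbove_image (hφ.continuous_fderiv one_ne_zero).norm.continuousOn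
  refine hs.norm_image_sub_le_of_norm_fderiv_le (𝕜 := ℝ)
    (fun x _ => hφ.differentiable one_ne_zero x) (fun x hx => ?_) hb ha
  rw [← norm_gradient_eq_norm_fderiv]
  exact le_csSup hbdd (mem_image_of_mem _ hx)

end GradientFlow

/-- **Uniform-in-time Lipschitz bound for the zeroth-order coefficient
`u₀(x,t) = φ(y_x(t))`** (Theorem `p:main` (i), derivative estimate, in integrated form):
for each `t ≥ 0` the map `x ↦ u₀(x,t)` is `(‖φ‖_{C¹(B(0,R))} e^{−γt})`-Lipschitz on
`B(0,R)`, where `‖φ‖_{C¹(B(0,R))} = sup_{B(0,R)}|φ| + sup_{B(0,R)}‖∇φ‖`. -/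
theorem u0_exponential_lipschitz
    (d : ℕ) (hd : 1 ≤ d)
    (f : EuclideanSpace ℝ (Fin d) → ℝ)
    (γ R : ℝ) (hγ : 0 < γ) (hR : 0 < R)
    (hsmooth : ContDiff ℝ 1 f)
    (hconv : ConvexOn ℝ (closedBall (0 : EuclideanSpace ℝ (Fin d)) R)
      (fun x => f x - γ / 2 * ‖x‖ ^ 2))
    (hgrad0 : gradient f (0 : EuclideanSpace ℝ (Fin d)) = 0)
    (y : EuclideanSpace ℝ (Fin d) → ℝ → EuclideanSpace ℝ (Fin d))
    (hy0 : ∀ x ∈ closedBall (0 : EuclideanSpace ℝ (Fin d)) R, y x 0 = x)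
    (hyflow : ∀ x ∈ closedBall (0 : EuclideanSpace ℝ (Fin d)) R,
      ∀ t ≥ (0 : ℝ), HasDerivAt (y x) (-gradient f (y x t)) t)
    (φ : EuclideanSpace ℝ (Fin d) → ℝ) (hφ : ContDiff ℝ 1 φ) :
    ∀ t ≥ (0 : ℝ),
      ∀ x ∈ closedBall (0 : EuclideanSpace ℝ (Fin d)) R,
        ∀ z ∈ closedBall (0 : EuclideanSpace ℝ (Fin d)) R,
          |φ (y x t) - φ (y z t)| ≤
            (sSup ((fun w => |φ w|) '' closedBall (0 : EuclideanSpace ℝ (Fin d)) R) +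
              sSup ((fun w => ‖gradient φ w‖) '' closedBall (0 : EuclideanSpace ℝ (Fin d)) R)) *
              Real.exp (-γ * t) * ‖x - z‖ := by
  intro t ht x hx z hz
  have hd : Differentiable ℝ f := hsmooth.differentiable one_ne_zero
  have hmono := fun a ha b hb =>
    hconv.mul_norm_sq_le_inner_gradient_sub hd (a := a) (b := b) ha hb
  have hin (a : EuclideanSpace ℝ (Fin d)) (ha : ‖a‖ = R) : 0 < inner ℝ (gradient f a) a := by
    have h := hmono a (by simp [ha]) 0 (by simp [hR.le])
    rw [hgrad0, sub_zero, sub_zero, ha] at h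
    exact lt_of_lt_of_le (by positivity) h
  have hmem : ∀ p ∈ closedBall (0 : EuclideanSpace ℝ (Fin d)) R, ∀ r ≥ (0 : ℝ),
      y p r ∈ closedBall (0 : EuclideanSpace ℝ (Fin d)) R := fun p hp r hr => by
    refine mem_closedBall_zero_iff.2 (norm_le_of_hasDerivAt_neg hR.le hin ?_ (hyflow p hp) hr)
    rw [hy0 p hp]
    exact mem_closedBall_zero_iff.1 hp
  have hdist := norm_sub_le_exp_mul_of_hasDerivAt_neg hmono (hmem x hx) (hmem z hz)
    (hyflow x hx) (hyflow z hz) ht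
  rw [hy0 x hx, hy0 z hz] at hdist
  have hsup : 0 ≤ sSup ((fun w => |φ w|) '' closedBall (0 : EuclideanSpace ℝ (Fin d)) R) :=
    Real.sSup_nonneg (by rintro _ ⟨w, -, rfl⟩; exact abs_nonneg _)
  have hsup' : 0 ≤ sSup ((fun w => ‖gradient φ w‖) ''
      closedBall (0 : EuclideanSpace ℝ (Fin d)) R) :=
    Real.sSup_nonneg (by rintro _ ⟨w, -, rfl⟩; exact norm_nonneg _)
  refine (abs_sub_le_sSup_norm_gradient_mul_s7 (convex_closedBall 0 R) (isCompact_closedBall 0 R) hφ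
    (hmem x hx t ht) (hmem z hz t ht)).trans ?_
  rw [mul_assoc]
  exact mul_le_mul (le_add_of_nonneg_left hsup) hdist (norm_nonneg _) (add_nonneg hsup hsup')
end

section
/- Under the SGD setting, assume additionally that each f(·;ξ) is seven times continuously differentiable on B(0,R₁), that ∇f(0)=0, and let φ : ℝ^d → ℝ be six times continuously differentiable. Let R ∈ (R₀, R₁]. Then there exist constants C = C(φ, f, R) > 0 and c > 0 such that for every step size η ∈ (0, η₀] and every n with nη ≥ c·log(1/η), sup_{x∈B(0,R)} | E_x[φ(X_n)] − φ(0) | ≤ C η, where E_x denotes expectation for the SGD chain with (ξ_n) i.i.d. uniform on Ξ and X₀ = x. -/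
open Metric Set

/-- `E_x[φ(X_n)]` for the SGD chain with i.i.d. uniform noise on the finite set `Ξ`. -/
noncomputable def sgdExp {d : ℕ} {Ξ : Type} [Fintype Ξ]
    (g : Ξ → EuclideanSpace ℝ (Fin d) → EuclideanSpace ℝ (Fin d)) (η : ℝ) (n : ℕ)
    (x : EuclideanSpace ℝ (Fin d)) (φ : EuclideanSpace ℝ (Fin d) → ℝ) : ℝ :=
  ((Fintype.card Ξ : ℝ) ^ n)⁻¹ * ∑ ω : Fin n → Ξ, φ (sgdIter g η (List.ofFn ω) x)

section SgdExpectation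

variable {d : ℕ} {Ξ : Type} [Fintype Ξ]
  {g : Ξ → EuclideanSpace ℝ (Fin d) → EuclideanSpace ℝ (Fin d)} {η R : ℝ}

/-- The one-step transition operator of the SGD chain. -/
noncomputable def sgdStep (g : Ξ → EuclideanSpace ℝ (Fin d) → EuclideanSpace ℝ (Fin d)) (η : ℝ)
    (φ : EuclideanSpace ℝ (Fin d) → ℝ) (x : EuclideanSpace ℝ (Fin d)) : ℝ :=
  (Fintype.card Ξ : ℝ)⁻¹ * ∑ ξ : Ξ, φ (x - η • g ξ x)

lemma sgdExp_zero (x : EuclideanSpace ℝ (Fin d)) (φ : EuclideanSpace ℝ (Fin d) → ℝ) :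
    sgdExp g η 0 x φ = φ x := by
  simp [sgdExp, sgdIter]

lemma sgdExp_succ_eq_sgdStep (n : ℕ) (x : EuclideanSpace ℝ (Fin d))
    (φ : EuclideanSpace ℝ (Fin d) → ℝ) :
    sgdExp g η (n + 1) x φ = sgdStep g η (fun y => sgdExp g η n y φ) x := by
  simp only [sgdExp, sgdStep]
  rw [← (Fin.consEquiv (fun _ : Fin (n + 1) => Ξ)).sum_comp, Fintype.sum_prod_type,
    ← Finset.mul_sum, ← mul_assoc, pow_succ, mul_inv_rev]
  simp [Fin.consEquiv, List.ofFn_succ, sgdIter]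

lemma sgdExp_succ (n : ℕ) (x : EuclideanSpace ℝ (Fin d))
    (φ : EuclideanSpace ℝ (Fin d) → ℝ) :
    sgdExp g η (n + 1) x φ = sgdExp g η n x (sgdStep g η φ) := by
  induction n generalizing x with
  | zero => simp [sgdExp_succ_eq_sgdStep, sgdExp_zero]
  | succ n ih =>
    rw [sgdExp_succ_eq_sgdStep, funext ih, ← sgdExp_succ_eq_sgdStep]

lemma sgdExp_add (n : ℕ) (x : EuclideanSpace ℝ (Fin d)) (φ ψ : EuclideanSpace ℝ (Fin d) → ℝ) :
    sgdExp g η n x (fun y => φ y + ψ y) = sgdExp g η n x φ + sgdExp g η n x ψ := by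
  simp only [sgdExp, Finset.sum_add_distrib, mul_add]

lemma sgdExp_sub (n : ℕ) (x : EuclideanSpace ℝ (Fin d)) (φ ψ : EuclideanSpace ℝ (Fin d) → ℝ) :
    sgdExp g η n x (fun y => φ y - ψ y) = sgdExp g η n x φ - sgdExp g η n x ψ := by
  simp only [sgdExp, Finset.sum_sub_distrib, mul_sub]

lemma sgdExp_const_mul (n : ℕ) (x : EuclideanSpace ℝ (Fin d)) (a : ℝ)
    (φ : EuclideanSpace ℝ (Fin d) → ℝ) :
    sgdExp g η n x (fun y => a * φ y) = a * sgdExp g η n x φ := by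
  simp only [sgdExp, ← Finset.mul_sum]
  ring

lemma sgdExp_const [Nonempty Ξ] (n : ℕ) (x : EuclideanSpace ℝ (Fin d)) (a : ℝ) :
    sgdExp g η n x (fun _ => a) = a := by
  simp [sgdExp]

lemma sgdExp_mono (hinv : ∀ ξ, ∀ x ∈ closedBall 0 R, x - η • g ξ x ∈ closedBall 0 R)
    {φ ψ : EuclideanSpace ℝ (Fin d) → ℝ} (h : ∀ x ∈ closedBall 0 R, φ x ≤ ψ x)
    (n : ℕ) {x : EuclideanSpace ℝ (Fin d)} (hx : x ∈ closedBall 0 R) :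
    sgdExp g η n x φ ≤ sgdExp g η n x ψ := by
  induction n generalizing x with
  | zero => simpa [sgdExp_zero] using h x hx
  | succ n ih =>
    simp only [sgdExp_succ_eq_sgdStep, sgdStep]
    gcongr with ξ
    exact ih (hinv ξ x hx)

lemma abs_sgdExp_sub_le (hinv : ∀ ξ, ∀ x ∈ closedBall 0 R, x - η • g ξ x ∈ closedBall 0 R)
    {φ ψ χ : EuclideanSpace ℝ (Fin d) → ℝ} (h : ∀ x ∈ closedBall 0 R, |φ x - ψ x| ≤ χ x)
    (n : ℕ) {x : EuclideanSpace ℝ (Fin d)} (hx : x ∈ closedBall 0 R) :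
    |sgdExp g η n x φ - sgdExp g η n x ψ| ≤ sgdExp g η n x χ := by
  rw [← sgdExp_sub, abs_le]
  refine ⟨?_, sgdExp_mono hinv (fun y hy => (abs_le.1 (h y hy)).2) n hx⟩
  have := sgdExp_mono (φ := fun y => (-1) * χ y) (ψ := fun y => φ y - ψ y) hinv
    (fun y hy => by linarith [(abs_le.1 (h y hy)).1]) n hx
  rw [sgdExp_const_mul] at this
  linarith

lemma sgdExp_norm_sq_le [Nonempty Ξ]
    (hinv : ∀ ξ, ∀ x ∈ closedBall 0 R, x - η • g ξ x ∈ closedBall 0 R)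
    {γ B : ℝ} (hγ : 0 < γ) (hη : 2 * γ * η ≤ 1)
    (hB : ∀ ξ, ∀ x ∈ closedBall 0 R, ‖g ξ x‖ ≤ B)
    (hmono : ∀ x ∈ closedBall 0 R,
      γ * ‖x‖ ^ 2 ≤ inner ℝ x ((Fintype.card Ξ : ℝ)⁻¹ • ∑ ξ, g ξ x))
    (hη0 : 0 < η) (n : ℕ) {x : EuclideanSpace ℝ (Fin d)} (hx : x ∈ closedBall 0 R) :
    sgdExp g η n x (fun y => ‖y‖ ^ 2) ≤
      (1 - 2 * γ * η) ^ n * R ^ 2 + η * (B ^ 2 / (2 * γ)) := by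
  induction n with
  | zero =>
    have : ‖x‖ ^ 2 ≤ R ^ 2 := by
      gcongr
      simpa using hx
    rw [sgdExp_zero]
    have : 0 ≤ η * (B ^ 2 / (2 * γ)) := by positivity
    linarith
  | succ n ih =>
    have hc : (Fintype.card Ξ : ℝ) ≠ 0 := by simp
    have step : ∀ y ∈ closedBall 0 R, sgdStep g η (fun y => ‖y‖ ^ 2) y ≤
        (1 - 2 * γ * η) * ‖y‖ ^ 2 + η ^ 2 * B ^ 2 := by
      intro y hy
      have h1 : ∀ ξ, ‖y - η • g ξ y‖ ^ 2 ≤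
          ‖y‖ ^ 2 - 2 * η * inner ℝ y (g ξ y) + η ^ 2 * B ^ 2 := by
        intro ξ
        rw [norm_sub_sq_real, norm_smul, inner_smul_right, mul_pow, Real.norm_eq_abs, sq_abs]
        have : ‖g ξ y‖ ^ 2 ≤ B ^ 2 := by
          gcongr
          exact hB ξ y hy
        nlinarith [mul_le_mul_of_nonneg_left this (sq_nonneg η)]
      have h2 := hmono y hy
      calc sgdStep g η (fun y => ‖y‖ ^ 2) y
          ≤ (Fintype.card Ξ : ℝ)⁻¹ *
            ∑ ξ, (‖y‖ ^ 2 - 2 * η * inner ℝ y (g ξ y) + η ^ 2 * B ^ 2) := by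
            unfold sgdStep
            gcongr with ξ
            exact h1 ξ
        _ = ‖y‖ ^ 2 - 2 * η * inner ℝ y ((Fintype.card Ξ : ℝ)⁻¹ • ∑ ξ, g ξ y)
            + η ^ 2 * B ^ 2 := by
            rw [inner_smul_right, inner_sum, Finset.sum_add_distrib, Finset.sum_sub_distrib,
              ← Finset.mul_sum]
            simp only [Finset.sum_const, Finset.card_univ, nsmul_eq_mul]
            field_simp
        _ ≤ _ := by nlinarith
    rw [sgdExp_succ]
    refine (sgdExp_mono hinv step n hx).trans ?_
    rw [sgdExp_add, sgdExp_const_mul, sgdExp_const]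
    have h3 := mul_le_mul_of_nonneg_left ih (by linarith : 0 ≤ 1 - 2 * γ * η)
    refine (add_le_add_left h3 _).trans (le_of_eq ?_)
    field_simp
    ring

lemma abs_sgdExp_clm_le [Nonempty Ξ]
    (hinv : ∀ ξ, ∀ x ∈ closedBall 0 R, x - η • g ξ x ∈ closedBall 0 R)
    {γ M K : ℝ} (hγ : 0 < γ) (hη0 : 0 < η) (hη : 2 * γ * η ≤ 1) (hK : 0 ≤ K) (hM : 0 ≤ M)
    {H : EuclideanSpace ℝ (Fin d) →L[ℝ] EuclideanSpace ℝ (Fin d)}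
    (hH : ∀ x ∈ closedBall 0 R, ‖(Fintype.card Ξ : ℝ)⁻¹ • ∑ ξ, g ξ x - H x‖ ≤ K * ‖x‖ ^ 2)
    (hcontr : ‖ContinuousLinearMap.id ℝ _ - η • H‖ ≤ 1 - γ * η / 2)
    {x : EuclideanSpace ℝ (Fin d)} (hx : x ∈ closedBall 0 R)
    (hsq : ∀ n, sgdExp g η n x (fun y => ‖y‖ ^ 2) ≤ (1 - 2 * γ * η) ^ n * R ^ 2 + η * M)
    (n : ℕ) (l : EuclideanSpace ℝ (Fin d) →L[ℝ] ℝ) :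
    |sgdExp g η n x l| ≤ ‖l‖ * ((1 - γ * η / 2) ^ n * (R + K * R ^ 2 / γ)
      - (1 - 2 * γ * η) ^ n * (K * R ^ 2 / γ) + η * (2 * K * M / γ)) := by
  have hη1 : 0 ≤ 1 - 2 * γ * η := by linarith
  have hγη : 0 < γ * η := by positivity
  induction n generalizing l with
  | zero =>
    rw [sgdExp_zero]
    have h1 : |l x| ≤ ‖l‖ * R :=
      (l.le_opNorm x).trans (by gcongr; simpa using hx)
    have h2 : 0 ≤ ‖l‖ * (η * (2 * K * M / γ)) := by positivity
    simp only [pow_zero]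
    linarith
  | succ n ih =>
    set l' := l.comp (ContinuousLinearMap.id ℝ _ - η • H) with hl'
    have hl'norm : ‖l'‖ ≤ ‖l‖ * (1 - γ * η / 2) :=
      (l.opNorm_comp_le _).trans (by gcongr)
    have hc : (Fintype.card Ξ : ℝ) ≠ 0 := by simp
    have step : ∀ y ∈ closedBall 0 R, |sgdStep g η l y - l' y| ≤ (η * ‖l‖ * K) * ‖y‖ ^ 2 := by
      intro y hy
      have h1 : sgdStep g η l y - l' y =
          -(η * l ((Fintype.card Ξ : ℝ)⁻¹ • ∑ ξ, g ξ y - H y)) := by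
        simp only [sgdStep, hl', map_sub, map_smul, map_sum, Finset.sum_sub_distrib,
          ← Finset.mul_sum, smul_eq_mul, Finset.sum_const, Finset.card_univ, nsmul_eq_mul,
          ContinuousLinearMap.comp_apply, sub_apply,
          smul_apply, ContinuousLinearMap.id_apply]
        field_simp
        ring
      rw [h1, abs_neg, abs_mul, abs_of_pos hη0, mul_assoc, mul_assoc]
      gcongr
      exact (l.le_opNorm _).trans (by gcongr; exact hH y hy)
    have h2 := abs_sgdExp_sub_le hinv step n hx
    rw [← sgdExp_succ, sgdExp_const_mul] at h2
    have h3 : η * ‖l‖ * K * sgdExp g η n x (fun y => ‖y‖ ^ 2) ≤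
        η * ‖l‖ * K * ((1 - 2 * γ * η) ^ n * R ^ 2 + η * M) := by
      gcongr
      exact hsq n
    have hpow : (1 - 2 * γ * η) ^ n ≤ (1 - γ * η / 2) ^ n := by
      gcongr
      linarith
    have hR : 0 ≤ R := (norm_nonneg x).trans (by simpa using hx)
    have h4 : ‖l'‖ * ((1 - γ * η / 2) ^ n * (R + K * R ^ 2 / γ)
          - (1 - 2 * γ * η) ^ n * (K * R ^ 2 / γ) + η * (2 * K * M / γ)) ≤
        ‖l‖ * (1 - γ * η / 2) * ((1 - γ * η / 2) ^ n * (R + K * R ^ 2 / γ)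
          - (1 - 2 * γ * η) ^ n * (K * R ^ 2 / γ) + η * (2 * K * M / γ)) := by
      refine mul_le_mul_of_nonneg_right hl'norm ?_
      have h5 : 0 ≤ (1 - γ * η / 2) ^ n * R :=
        mul_nonneg (pow_nonneg (by linarith) n) hR
      have h6 := mul_le_mul_of_nonneg_right hpow (by positivity : 0 ≤ K * R ^ 2 / γ)
      have h7 : 0 ≤ η * (2 * K * M / γ) := by positivity
      linarith
    have h8 : 0 ≤ ‖l‖ * ((1 - 2 * γ * η) ^ n * (K * R ^ 2 * η / 2)) := by
      have := pow_nonneg hη1 n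
      positivity
    have h9 : ‖l‖ * (1 - γ * η / 2) * ((1 - γ * η / 2) ^ n * (R + K * R ^ 2 / γ)
          - (1 - 2 * γ * η) ^ n * (K * R ^ 2 / γ) + η * (2 * K * M / γ))
        + η * ‖l‖ * K * ((1 - 2 * γ * η) ^ n * R ^ 2 + η * M)
        + ‖l‖ * ((1 - 2 * γ * η) ^ n * (K * R ^ 2 * η / 2)) =
        ‖l‖ * ((1 - γ * η / 2) ^ (n + 1) * (R + K * R ^ 2 / γ)
          - (1 - 2 * γ * η) ^ (n + 1) * (K * R ^ 2 / γ) + η * (2 * K * M / γ)) := by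
      field_simp
      ring
    have h10 := abs_sub_abs_le_abs_sub (sgdExp g η (n + 1) x l) (sgdExp g η n x l')
    linarith [ih l']

end SgdExpectation

/-- A function that is `C²` at `0` and bounded on a ball has a quadratic first-order Taylor
remainder on the whole ball. -/
lemma exists_norm_sub_fderiv_le_sq {E F : Type*} [NormedAddCommGroup E] [NormedSpace ℝ E]
    [NormedAddCommGroup F] [NormedSpace ℝ F] {u : E → F} (hu : ContDiffAt ℝ 2 u 0)
    {R M : ℝ} (hM : ∀ x ∈ closedBall (0 : E) R, ‖u x‖ ≤ M) :
    ∃ K : ℝ, 0 ≤ K ∧ ∀ x ∈ closedBall (0 : E) R,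
      ‖u x - u 0 - fderiv ℝ u 0 x‖ ≤ K * ‖x‖ ^ 2 := by
  have hf' : ContDiffAt ℝ 1 (fderiv ℝ u) 0 := hu.fderiv_right (by norm_num)
  obtain ⟨L, t, ht, hL⟩ := hf'.exists_lipschitzOnWith
  have hd : ∀ᶠ x in nhds (0 : E), DifferentiableAt ℝ u x :=
    (hu.eventually (by simp)).mono fun x hx => hx.differentiableAt (by simp)
  obtain ⟨ρ, hρ, hρs⟩ := Metric.eventually_nhds_iff_ball.1 (hd.and ht)
  set N := ‖fderiv ℝ u 0‖
  refine ⟨L + (2 * |M| / ρ ^ 2 + N / ρ), by positivity, fun x hx => ?_⟩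
  rcases lt_or_ge ‖x‖ ρ with h | h
  · have hsub : closedBall (0 : E) ‖x‖ ⊆ ball 0 ρ := closedBall_subset_ball h
    have := (convex_closedBall (0 : E) ‖x‖).norm_image_sub_le_of_norm_hasFDerivWithin_le'
      (f := u) (f' := fderiv ℝ u) (φ := fderiv ℝ u 0) (C := L * ‖x‖) (x := 0) (y := x)
      (fun y hy => (hρs y (hsub hy)).1.hasFDerivAt.hasFDerivWithinAt)
      (fun y hy => by
        have h1 := hL.norm_sub_le (hρs y (hsub hy)).2 (mem_of_mem_nhds ht)
        refine h1.trans ?_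
        gcongr
        simpa using hy)
      (by simp) (by simp)
    rw [sub_zero] at this
    have h2 : 0 ≤ (2 * |M| / ρ ^ 2 + N / ρ) * ‖x‖ ^ 2 := by positivity
    nlinarith
  · have hR : 0 ≤ R := (norm_nonneg x).trans (by simpa using hx)
    have h1 : ‖u x‖ ≤ |M| := (hM x hx).trans (le_abs_self M)
    have h2 : ‖u 0‖ ≤ |M| := (hM 0 (by simpa using hR)).trans (le_abs_self M)
    have h3 : ‖fderiv ℝ u 0 x‖ ≤ N * ‖x‖ := (fderiv ℝ u 0).le_opNorm x
    have h4 : ‖u x - u 0 - fderiv ℝ u 0 x‖ ≤ 2 * |M| + N * ‖x‖ := by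
      refine (norm_sub_le _ _).trans ?_
      linarith [norm_sub_le (u x) (u 0)]
    have h5 : 1 ≤ ‖x‖ / ρ := (one_le_div hρ).2 h
    have h6 : 2 * |M| * 1 ≤ 2 * |M| * (‖x‖ / ρ) ^ 2 := by
      gcongr
      exact one_le_pow₀ h5
    have h7 : N * ‖x‖ * 1 ≤ N * ‖x‖ * (‖x‖ / ρ) := by gcongr
    have h8 : 0 ≤ L * ‖x‖ ^ 2 := by positivity
    have h9 : (L + (2 * |M| / ρ ^ 2 + N / ρ)) * ‖x‖ ^ 2 = L * ‖x‖ ^ 2 +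
        2 * |M| * (‖x‖ / ρ) ^ 2 + N * ‖x‖ * (‖x‖ / ρ) := by
      field_simp
      ring
    linarith

/-- The first-order monotonicity inequality for a strongly convex function on a ball. -/
lemma mul_norm_sq_le_inner_gradient_sub {E : Type*} [NormedAddCommGroup E]
    [InnerProductSpace ℝ E] [CompleteSpace E] {u : E → ℝ} (hu : Differentiable ℝ u) {γ R : ℝ}
    (hconv : ConvexOn ℝ (closedBall (0 : E) R) (fun x => u x - γ / 2 * ‖x‖ ^ 2))
    {x : E} (hx : x ∈ closedBall (0 : E) R) :
    γ * ‖x‖ ^ 2 ≤ inner ℝ x (gradient u x - gradient u 0) := by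
  have hR : 0 ≤ R := (norm_nonneg x).trans (by simpa using hx)
  set p : ℝ → ℝ := fun t => u (t • x) - γ / 2 * ‖t • x‖ ^ 2
  have hpc : ConvexOn ℝ (Icc 0 1) p := by
    have := hconv.comp_linearMap (LinearMap.toSpanSingleton ℝ E x)
    refine this.subset (fun t ht => ?_) (convex_Icc 0 1)
    simp only [mem_preimage, LinearMap.toSpanSingleton_apply, mem_closedBall, dist_zero_right,
      norm_smul, Real.norm_eq_abs, abs_of_nonneg ht.1] at hx ⊢
    nlinarith [ht.2, norm_nonneg x]
  have hpd : ∀ t, HasDerivAt p (inner ℝ (gradient u (t • x)) x - γ * t * ‖x‖ ^ 2) t := by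
    intro t
    have h1 : HasDerivAt (fun t : ℝ => t • x) x t := by
      simpa using (hasDerivAt_id t).smul_const x
    have h2 : HasDerivAt (fun t : ℝ => u (t • x)) (inner ℝ (gradient u (t • x)) x) t := by
      rw [← InnerProductSpace.toDual_apply_apply]
      exact (hu (t • x)).hasGradientAt.hasFDerivAt.comp_hasDerivAt t h1
    have h3 : HasDerivAt (fun t : ℝ => γ / 2 * ‖t • x‖ ^ 2) (γ * t * ‖x‖ ^ 2) t := by
      have h4 : (fun t : ℝ => γ / 2 * ‖t • x‖ ^ 2) = fun t => γ / 2 * ‖x‖ ^ 2 * t ^ 2 := by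
        ext t
        rw [norm_smul, mul_pow, Real.norm_eq_abs, sq_abs]
        ring
      rw [h4]
      refine ((hasDerivAt_pow 2 t).const_mul (γ / 2 * ‖x‖ ^ 2)).congr_deriv ?_
      push_cast
      ring
    exact h2.sub h3
  have h0 := hpc.le_slope_of_hasDerivAt (by simp) (by simp) one_pos (hpd 0)
  have h1 := hpc.slope_le_of_hasDerivAt (by simp) (by simp) one_pos (hpd 1)
  have := h0.trans h1
  rw [zero_smul, one_smul, real_inner_comm, real_inner_comm x] at this
  rw [inner_sub_right]
  linarith

/-- The SGD step maps the ball of radius `R` into itself for admissible step sizes. -/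
lemma norm_sub_smul_le_of_step_size {E : Type*} [NormedAddCommGroup E] [InnerProductSpace ℝ E]
    {γ b R η : ℝ} (hγ : 0 < γ) (hb : 0 < b) (hη0 : 0 < η) (h1 : 2 * γ * η ≤ 1)
    (h3 : η * (2 * γ * b * R + b ^ 2) ≤ 3 * γ * R ^ 2 / 8 - 2 * b * R)
    {x v : E} (hx : ‖x‖ ≤ R) (hv : ‖v‖ ≤ b + γ * ‖x‖)
    (hxv : γ * ‖x‖ ^ 2 - b * ‖x‖ ≤ inner ℝ x v) : ‖x - η • v‖ ≤ R := by
  have hR : 0 ≤ R := (norm_nonneg x).trans hx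
  have hr := norm_nonneg x
  refine le_of_sq_le_sq ?_ hR
  rw [norm_sub_sq_real, norm_smul, inner_smul_right, mul_pow, Real.norm_eq_abs, sq_abs]
  have hv2 : ‖v‖ ^ 2 ≤ (b + γ * ‖x‖) ^ 2 := by gcongr
  have e1 := mul_le_mul_of_nonneg_left hv2 (sq_nonneg η)
  have e2 := mul_le_mul_of_nonneg_left hxv (by positivity : 0 ≤ 2 * η)
  have e3 : (1 - η * γ) ^ 2 * ‖x‖ ^ 2 ≤ (1 - η * γ) ^ 2 * R ^ 2 := by gcongr
  have e4 : 2 * η * b * (1 + η * γ) * ‖x‖ ≤ 2 * η * b * (1 + η * γ) * R := by gcongr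
  have e5 := mul_le_mul_of_nonneg_left h3 hη0.le
  have e6 := mul_le_mul_of_nonneg_left h1 (by positivity : 0 ≤ η * γ * R ^ 2)
  nlinarith [mul_nonneg (mul_nonneg hη0.le hγ.le) (sq_nonneg R)]

lemma norm_id_sub_smul_le {E : Type*} [NormedAddCommGroup E] [InnerProductSpace ℝ E]
    {H : E →L[ℝ] E} {γ η : ℝ} (hη0 : 0 ≤ η) (hη : 2 * γ * η ≤ 1)
    (hH : ∀ x, γ * ‖x‖ ^ 2 ≤ inner ℝ x (H x)) (hηH : η * ‖H‖ ^ 2 ≤ γ) :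
    ‖ContinuousLinearMap.id ℝ E - η • H‖ ≤ 1 - γ * η / 2 := by
  refine ContinuousLinearMap.opNorm_le_bound _ (by linarith) fun x => ?_
  refine le_of_sq_le_sq ?_ (mul_nonneg (by linarith) (norm_nonneg x))
  simp only [sub_apply, smul_apply,
    ContinuousLinearMap.id_apply]
  rw [norm_sub_sq_real, norm_smul, inner_smul_right, mul_pow, Real.norm_eq_abs, sq_abs]
  have h1 : ‖H x‖ ^ 2 ≤ (‖H‖ * ‖x‖) ^ 2 := by
    gcongr
    exact H.le_opNorm x
  have h2 := mul_le_mul_of_nonneg_left h1 (sq_nonneg η)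
  have h3 := mul_le_mul_of_nonneg_left (hH x) hη0
  have h4 := mul_le_mul_of_nonneg_right hηH (by positivity : 0 ≤ η * ‖x‖ ^ 2)
  nlinarith [sq_nonneg (γ * η * ‖x‖)]

/-- A strong monotonicity inequality at `0` passes to the derivative. -/
lemma mul_norm_sq_le_inner_of_monotone {E : Type*} [NormedAddCommGroup E]
    [InnerProductSpace ℝ E] {G : E → E} {H : E →L[ℝ] E} {γ K R : ℝ} (hR : 0 < R)
    (hmono : ∀ x ∈ closedBall (0 : E) R, γ * ‖x‖ ^ 2 ≤ inner ℝ x (G x))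
    (hGH : ∀ x ∈ closedBall (0 : E) R, ‖G x - H x‖ ≤ K * ‖x‖ ^ 2) (x : E) :
    γ * ‖x‖ ^ 2 ≤ inner ℝ x (H x) := by
  have key : ∀ᶠ t : ℝ in nhdsWithin 0 (Ioi 0),
      γ * ‖x‖ ^ 2 ≤ inner ℝ x (H x) + t * (K * ‖x‖ ^ 3) := by
    have hcont : ContinuousAt (fun t : ℝ => t • x) 0 := by fun_prop
    have hball : ∀ᶠ t : ℝ in nhds 0, t • x ∈ closedBall (0 : E) R :=
      hcont (by simpa only [zero_smul] using closedBall_mem_nhds (0 : E) hR)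
    filter_upwards [nhdsWithin_le_nhds hball, self_mem_nhdsWithin] with t ht (ht0 : 0 < t)
    have h1 := hmono _ ht
    have h2 : inner ℝ (t • x) (G (t • x) - H (t • x)) ≤ ‖t • x‖ * (K * ‖t • x‖ ^ 2) :=
      (real_inner_le_norm _ _).trans (by gcongr; exact hGH _ ht)
    rw [inner_sub_right, map_smul, inner_smul_left _ (t • H x), inner_smul_right] at h2
    simp only [norm_smul, Real.norm_eq_abs, abs_of_pos ht0, conj_trivial] at h1 h2
    have h3 : t ^ 2 * (γ * ‖x‖ ^ 2) ≤ t ^ 2 * (inner ℝ x (H x) + t * (K * ‖x‖ ^ 3)) := by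
      linarith
    exact le_of_mul_le_mul_left h3 (by positivity)
  refine ge_of_tendsto (Filter.Tendsto.mono_left ?_ nhdsWithin_le_nhds) key
  have : ContinuousAt (fun t : ℝ => inner ℝ x (H x) + t * (K * ‖x‖ ^ 3)) 0 := by fun_prop
  simpa [ContinuousAt] using this

lemma contDiffAt_gradient {d : ℕ} {u : EuclideanSpace ℝ (Fin d) → ℝ}
    {x : EuclideanSpace ℝ (Fin d)} (hu : ContDiffAt ℝ 3 u x) :
    ContDiffAt ℝ 2 (gradient u) x := by
  refine contDiffAt_euclidean.2 fun i => ?_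
  have h : (fun y => gradient u y i) = fun y => fderiv ℝ u y (EuclideanSpace.single i 1) := by
    ext y
    rw [gradient, ← InnerProductSpace.toDual_symm_apply, EuclideanSpace.inner_single_right]
    simp
  rw [h]
  exact (hu.fderiv_right (by norm_num)).clm_apply contDiffAt_const

lemma gradient_const_mul_sum {E ι : Type*} [NormedAddCommGroup E] [InnerProductSpace ℝ E]
    [CompleteSpace E] [Fintype ι] {f : ι → E → ℝ} {x : E}
    (hf : ∀ i, DifferentiableAt ℝ (f i) x) (a : ℝ) :
    gradient (fun y => a * ∑ i, f i y) x = a • ∑ i, gradient (f i) x := by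
  refine HasGradientAt.gradient (hasGradientAt_iff_hasFDerivAt.2 ?_)
  have := (HasFDerivAt.fun_sum (u := Finset.univ)
    fun i _ => (hf i).hasGradientAt.hasFDerivAt).const_mul a
  simpa only [map_smul, map_sum, conj_trivial, LinearIsometryEquiv.map_smulₛₗ] using this

lemma one_sub_pow_le_of_log_le {a η : ℝ} (ha : 0 < a) (hη : 0 < η) (haη : a * η ≤ 1) {n : ℕ}
    (hn : 1 / a * Real.log (1 / η) ≤ n * η) : (1 - a * η) ^ n ≤ η := by
  calc (1 - a * η) ^ n ≤ Real.exp (-(a * η)) ^ n := by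
        refine pow_le_pow_left₀ (by linarith) ?_ n
        exact Real.one_sub_le_exp_neg _
    _ = Real.exp (n * -(a * η)) := (Real.exp_nat_mul _ _).symm
    _ ≤ Real.exp (Real.log η) := by
        gcongr
        rw [one_div η, Real.log_inv] at hn
        have := mul_le_mul_of_nonneg_left hn ha.le
        have h : a * (1 / a * -Real.log η) = -Real.log η := by field_simp
        linarith
    _ = η := Real.exp_log hη

/-- **SGD reaches an `O(η)` neighborhood of the minimum after `O(η⁻¹ log(1/η))` iterations**
(Corollary `cor:behaviorofUn`, first part): there are constants `C = C(φ,f,R) > 0` and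
`c > 0` such that for every `η ∈ (0,η₀]` and every `n` with `nη ≥ c log(1/η)`,
`sup_{x ∈ B(0,R)} |E_x[φ(X_n)] − φ(0)| ≤ C η`. -/
theorem sgd_objective_near_minimum_after_log_time
    (d : ℕ) (hd : 1 ≤ d) (Ξ : Type) [Fintype Ξ] [Nonempty Ξ]
    (f : Ξ → EuclideanSpace ℝ (Fin d) → ℝ)
    (fbar : EuclideanSpace ℝ (Fin d) → ℝ)
    (hfbar : ∀ x, fbar x = (Fintype.card Ξ : ℝ)⁻¹ * ∑ ξ : Ξ, f ξ x)
    (γ b R₁ : ℝ) (hγ : 0 < γ) (hb : 0 < b) (hR₁pos : 0 < R₁)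
    (hR₀R₁ : 16 * b / (3 * γ) < R₁)
    (hsmooth : ∀ ξ : Ξ, ContDiff ℝ 1 (f ξ))
    (hsmooth7 : ∀ ξ : Ξ, ContDiffOn ℝ 7 (f ξ) (closedBall (0 : EuclideanSpace ℝ (Fin d)) R₁))
    (hconv : ∀ ξ : Ξ, ConvexOn ℝ (closedBall (0 : EuclideanSpace ℝ (Fin d)) R₁)
      (fun x => f ξ x - γ / 2 * ‖x‖ ^ 2))
    (hgrad0 : ∀ ξ : Ξ, ‖gradient (f ξ) (0 : EuclideanSpace ℝ (Fin d))‖ ≤ b)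
    (hgradbd : ∀ ξ : Ξ, ∀ x ∈ closedBall (0 : EuclideanSpace ℝ (Fin d)) R₁,
      ‖gradient (f ξ) x‖ ≤ b + γ * ‖x‖)
    (hmin : gradient fbar (0 : EuclideanSpace ℝ (Fin d)) = 0)
    (φ : EuclideanSpace ℝ (Fin d) → ℝ) (hφ : ContDiff ℝ 6 φ)
    (R : ℝ) (hR₀R : 16 * b / (3 * γ) < R) (hRR₁ : R ≤ R₁) :
    ∃ C c : ℝ, 0 < C ∧ 0 < c ∧
      ∀ η : ℝ, 0 < η →
        η ≤ min (1 / (2 * γ))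
          (min (3 * R / (8 * b)) ((3 * γ * R ^ 2 / 8 - 2 * b * R) / (2 * γ * b * R + b ^ 2))) →
        ∀ n : ℕ, (n : ℝ) * η ≥ c * Real.log (1 / η) →
          ∀ x ∈ closedBall (0 : EuclideanSpace ℝ (Fin d)) R,
            |sgdExp (fun ξ z => gradient (f ξ) z) η n x φ - φ 0| ≤ C * η := by
  have hR : 0 < R := lt_trans (by positivity) hR₀R
  have hdiff : ∀ ξ, Differentiable ℝ (f ξ) := fun ξ => (hsmooth ξ).differentiable (by simp)
  set g : Ξ → EuclideanSpace ℝ (Fin d) → EuclideanSpace ℝ (Fin d) :=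
    fun ξ z => gradient (f ξ) z
  set G : EuclideanSpace ℝ (Fin d) → EuclideanSpace ℝ (Fin d) :=
    fun x => (Fintype.card Ξ : ℝ)⁻¹ • ∑ ξ, g ξ x with hG
  have hc : (Fintype.card Ξ : ℝ) ≠ 0 := by simp
  have hG0 : G 0 = 0 := by
    refine Eq.trans ?_ hmin
    rw [funext hfbar]
    exact (gradient_const_mul_sum (fun ξ => hdiff ξ 0) _).symm
  have hsub : closedBall (0 : EuclideanSpace ℝ (Fin d)) R ⊆ closedBall 0 R₁ :=
    closedBall_subset_closedBall hRR₁
  have hgmono : ∀ ξ, ∀ x ∈ closedBall 0 R, γ * ‖x‖ ^ 2 ≤ inner ℝ x (g ξ x - g ξ 0) :=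
    fun ξ x hx => mul_norm_sq_le_inner_gradient_sub (hdiff ξ) (hconv ξ) (hsub hx)
  have hGmono : ∀ x ∈ closedBall 0 R, γ * ‖x‖ ^ 2 ≤ inner ℝ x (G x) := by
    intro x hx
    calc γ * ‖x‖ ^ 2 = (Fintype.card Ξ : ℝ)⁻¹ * ∑ _ξ : Ξ, γ * ‖x‖ ^ 2 := by
          simp only [Finset.sum_const, Finset.card_univ, nsmul_eq_mul]
          field_simp
      _ ≤ (Fintype.card Ξ : ℝ)⁻¹ * ∑ ξ : Ξ, inner ℝ x (g ξ x - g ξ 0) := by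
          gcongr with ξ
          exact hgmono ξ x hx
      _ = inner ℝ x (G x - G 0) := by
          rw [← inner_sum, ← inner_smul_right, Finset.sum_sub_distrib, smul_sub]
      _ = inner ℝ x (G x) := by rw [hG0, sub_zero]
  have hB : ∀ ξ, ∀ x ∈ closedBall 0 R, ‖g ξ x‖ ≤ b + γ * R := by
    intro ξ x hx
    refine (hgradbd ξ x (hsub hx)).trans ?_
    gcongr
    simpa using hx
  have hGB : ∀ x ∈ closedBall 0 R, ‖G x‖ ≤ b + γ * R := by
    intro x hx
    rw [hG, norm_smul, norm_inv, Real.norm_natCast, inv_mul_le_iff₀ (by positivity)]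
    refine (norm_sum_le_of_le _ fun ξ _ => hB ξ x hx).trans (le_of_eq ?_)
    rw [Finset.sum_const, Finset.card_univ, nsmul_eq_mul]
  have hGsmooth : ContDiffAt ℝ 2 G 0 := by
    refine ContDiffAt.const_smul _ (ContDiffAt.sum fun ξ _ => contDiffAt_gradient ?_)
    exact ((hsmooth7 ξ).contDiffAt (closedBall_mem_nhds _ hR₁pos)).of_le (by norm_num)
  obtain ⟨K, hK, hGK⟩ := exists_norm_sub_fderiv_le_sq hGsmooth hGB
  set H := fderiv ℝ G 0
  simp only [hG0, sub_zero] at hGK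
  have hHpos := mul_norm_sq_le_inner_of_monotone hR hGmono hGK
  obtain ⟨M, hM⟩ :=
    (isCompact_closedBall (0 : EuclideanSpace ℝ (Fin d)) R).exists_bound_of_continuousOn
      hφ.continuous.continuousOn
  have hM0 : 0 ≤ M := (norm_nonneg _).trans (hM 0 (by simpa using hR.le))
  obtain ⟨L, hL, hφL⟩ := exists_norm_sub_fderiv_le_sq (hφ.contDiffAt.of_le (by norm_num)) hM
  set l := fderiv ℝ φ 0
  set V := (b + γ * R) ^ 2 / (2 * γ)
  have hV0 : 0 ≤ V := by positivity
  set η₁ := γ / (‖H‖ ^ 2 + 1) with hη₁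
  have hη₁pos : 0 < η₁ := by positivity
  set C₁ := L * (R ^ 2 + V) + ‖l‖ * (R + K * R ^ 2 / γ + 2 * K * V / γ) with hC₁
  have hC₁0 : 0 ≤ C₁ := by positivity
  refine ⟨2 * M / η₁ + C₁ + 1, 1 / (γ / 2), by positivity, by positivity, ?_⟩
  intro η hη hηle n hn x hx
  obtain ⟨hηγ, -, hηR⟩ := (by simpa only [le_min_iff] using hηle :
    η ≤ 1 / (2 * γ) ∧ η ≤ 3 * R / (8 * b) ∧
      η ≤ (3 * γ * R ^ 2 / 8 - 2 * b * R) / (2 * γ * b * R + b ^ 2))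
  rw [le_div_iff₀ (by positivity)] at hηγ hηR
  replace hηγ : 2 * γ * η ≤ 1 := by linarith
  have hinv : ∀ ξ, ∀ x ∈ closedBall 0 R, x - η • g ξ x ∈ closedBall 0 R := by
    intro ξ y hy
    rw [mem_closedBall_zero_iff] at hy ⊢
    refine norm_sub_smul_le_of_step_size hγ hb hη hηγ hηR hy
      (hgradbd ξ y (hsub (by simpa using hy))) ?_
    have h1 := hgmono ξ y (by simpa using hy)
    have h2 : |inner ℝ y (g ξ 0)| ≤ ‖y‖ * b :=
      (abs_real_inner_le_norm _ _).trans (by gcongr; exact hgrad0 ξ)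
    rw [inner_sub_right] at h1
    linarith [neg_abs_le (inner ℝ y (g ξ 0))]
  rcases le_or_gt η η₁ with hsmall | hlarge
  · have hηH : η * ‖H‖ ^ 2 ≤ γ := by
      rw [hη₁, le_div_iff₀ (by positivity)] at hsmall
      linarith
    have hsq := fun n => sgdExp_norm_sq_le hinv hγ hηγ hB hGmono hη n hx
    have hlin := abs_sgdExp_clm_le hinv hγ hη hηγ hK hV0 hGK
      (norm_id_sub_smul_le hη.le hηγ hHpos hηH) hx hsq n l
    have hrem := abs_sgdExp_sub_le (ψ := fun y => φ 0 + l y) (χ := fun y => L * ‖y‖ ^ 2) hinv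
      (fun y hy => by simpa only [sub_sub, Real.norm_eq_abs] using hφL y hy) n hx
    rw [sgdExp_add, sgdExp_const, sgdExp_const_mul] at hrem
    have hq : (1 - γ * η / 2) ^ n ≤ η := by
      have := one_sub_pow_le_of_log_le (half_pos hγ) hη (by linarith) hn
      rwa [div_mul_eq_mul_div] at this
    have hγη : 0 < γ * η := by positivity
    have hs0 : 0 ≤ (1 - 2 * γ * η) ^ n := pow_nonneg (by linarith) n
    have hs : (1 - 2 * γ * η) ^ n ≤ η :=
      (pow_le_pow_left₀ (by linarith) (by linarith) n).trans hq
    have hrem' : L * sgdExp g η n x (fun y => ‖y‖ ^ 2) ≤ L * (η * R ^ 2 + η * V) := by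
      gcongr
      exact (hsq n).trans (by gcongr)
    have hlin' : |sgdExp g η n x l| ≤
        ‖l‖ * (η * (R + K * R ^ 2 / γ) + η * (2 * K * V / γ)) := by
      refine hlin.trans ?_
      gcongr
      have h1 := mul_le_mul_of_nonneg_right hq (by positivity : 0 ≤ R + K * R ^ 2 / γ)
      have h2 : 0 ≤ (1 - 2 * γ * η) ^ n * (K * R ^ 2 / γ) := by positivity
      linarith
    have hfin : |sgdExp g η n x φ - φ 0| ≤ C₁ * η := by
      have htri := abs_add_le (sgdExp g η n x φ - (φ 0 + sgdExp g η n x l)) (sgdExp g η n x l)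
      rw [show sgdExp g η n x φ - (φ 0 + sgdExp g η n x l) + sgdExp g η n x l =
        sgdExp g η n x φ - φ 0 by ring] at htri
      rw [hC₁]
      linarith
    have : 0 ≤ (2 * M / η₁ + 1) * η := by positivity
    linarith
  · have hbd := abs_sgdExp_sub_le (ψ := fun _ => φ 0) (χ := fun _ => 2 * M) hinv
      (fun y hy => by
        have h1 := hM y hy
        have h2 := hM 0 (by simpa using hR.le)
        rw [← Real.norm_eq_abs]
        linarith [norm_sub_le (φ y) (φ 0)]) n hx
    rw [sgdExp_const, sgdExp_const] at hbd
    have h1 : 2 * M ≤ 2 * M / η₁ * η := by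
      rw [div_mul_eq_mul_div, le_div_iff₀ hη₁pos]
      gcongr
    have : 0 ≤ (C₁ + 1) * η := by positivity
    linarith
end

section
/- Let m ≥ 0 be an integer and let φ : ℝ → ℝ be (2m+2)-times continuously differentiable with bounded (2m+2)-th derivative, and let Z be a standard (mean 0, variance 1) Gaussian random variable. Then for every a ∈ ℝ and σ ≥ 0, | E[φ(a + σZ)] − Σ_{k=0}^m φ^{(2k)}(a) σ^{2k} / (2^k k!) | ≤ ((2m+1)!! / (2m+2)!) · sup_ℝ |φ^{(2m+2)}| · σ^{2m+2}, where (2m+1)!! denotes the double factorial (the (2m+2)-th absolute moment of Z is (2m+1)!!). -/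
open MeasureTheory ProbabilityTheory

lemma integrable_pow_gaussianReal (n : ℕ) :
    Integrable (fun z : ℝ => z ^ n) (gaussianReal 0 1) :=
  integrable_pow_of_mem_interior_integrableExpSet (X := id) (by simp) n

lemma integrable_gaussianPDFReal_mul_pow (n : ℕ) :
    Integrable (fun z : ℝ => gaussianPDFReal 0 1 z * z ^ n) := by
  have h := integrable_pow_gaussianReal n
  rw [gaussianReal_of_var_ne_zero 0 one_ne_zero,
    integrable_withDensity_iff_integrable_smul' (measurable_gaussianPDF 0 1)
      (Filter.Eventually.of_forall fun _ => gaussianPDF_lt_top)] at h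
  simpa using h

lemma hasDerivAt_gaussianPDFReal (z : ℝ) :
    HasDerivAt (gaussianPDFReal 0 1) (-z * gaussianPDFReal 0 1 z) z := by
  have h : HasDerivAt (fun x : ℝ => -(x - 0) ^ 2 / (2 * ((1 : NNReal) : ℝ))) (-z) z := by
    refine (((((hasDerivAt_id z).sub_const 0).pow 2).neg.div_const
      (2 * ((1 : NNReal) : ℝ)))).congr_deriv ?_
    simp
    ring
  refine (h.exp.const_mul (√(2 * Real.pi * ((1 : NNReal) : ℝ)))⁻¹).congr_deriv ?_
  rw [gaussianPDFReal_def]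
  ring

/-- The recursion for the moments of the standard Gaussian, by integration by parts. -/
lemma integral_pow_add_two_gaussianReal (n : ℕ) :
    ∫ z, z ^ (n + 2) ∂(gaussianReal 0 1) = (n + 1) * ∫ z, z ^ n ∂(gaussianReal 0 1) := by
  have hderiv (z : ℝ) : HasDerivAt (fun z : ℝ => gaussianPDFReal 0 1 z * z ^ (n + 1))
      ((n + 1) * (gaussianPDFReal 0 1 z * z ^ n) - gaussianPDFReal 0 1 z * z ^ (n + 2)) z := by
    refine ((hasDerivAt_gaussianPDFReal z).mul (hasDerivAt_pow (n + 1) z)).congr_deriv ?_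
    push_cast
    ring
  have hi := (integrable_gaussianPDFReal_mul_pow n).const_mul ((n : ℝ) + 1)
  have hi' := integrable_gaussianPDFReal_mul_pow (n + 2)
  have h := integral_eq_zero_of_hasDerivAt_of_integrable hderiv (hi.sub hi')
    (integrable_gaussianPDFReal_mul_pow (n + 1))
  rw [integral_sub hi hi', integral_const_mul] at h
  simp only [integral_gaussianReal_eq_integral_smul one_ne_zero, smul_eq_mul]
  linarith

lemma integral_pow_odd_gaussianReal (k : ℕ) :
    ∫ z, z ^ (2 * k + 1) ∂(gaussianReal 0 1) = 0 := by
  induction k with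
  | zero => simp
  | succ k ih =>
    rw [show 2 * (k + 1) + 1 = (2 * k + 1) + 2 by ring, integral_pow_add_two_gaussianReal, ih,
      mul_zero]

lemma integral_pow_even_gaussianReal (k : ℕ) :
    ∫ z, z ^ (2 * k) ∂(gaussianReal 0 1) =
      (Nat.factorial (2 * k) : ℝ) / (2 ^ k * (Nat.factorial k : ℝ)) := by
  induction k with
  | zero => simp
  | succ k ih =>
    rw [show 2 * (k + 1) = 2 * k + 2 by ring, integral_pow_add_two_gaussianReal, ih,
      Nat.factorial_succ (2 * k + 1), Nat.factorial_succ (2 * k), Nat.factorial_succ k]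
    have := Nat.factorial_ne_zero k
    push_cast
    field_simp
    ring

lemma integral_pow_even_gaussianReal_eq_doubleFactorial (k : ℕ) :
    ∫ z, z ^ (2 * k + 2) ∂(gaussianReal 0 1) = (Nat.doubleFactorial (2 * k + 1) : ℝ) := by
  induction k with
  | zero =>
    rw [integral_pow_add_two_gaussianReal]
    simp
  | succ k ih =>
    rw [integral_pow_add_two_gaussianReal, show 2 * (k + 1) = 2 * k + 2 by ring, ih,
      show 2 * k + 2 + 1 = (2 * k + 1) + 2 by ring, Nat.doubleFactorial_add_two]
    push_cast
    ring

lemma sum_range_two_mul_eq_sum_add (f : ℕ → ℝ) (n : ℕ) :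
    ∑ j ∈ Finset.range (2 * n), f j = ∑ k ∈ Finset.range n, (f (2 * k) + f (2 * k + 1)) := by
  induction n with
  | zero => simp
  | succ n ih =>
    rw [show 2 * (n + 1) = 2 * n + 1 + 1 by ring, Finset.sum_range_succ, Finset.sum_range_succ, ih,
      Finset.sum_range_succ, add_assoc]

lemma abs_sub_taylor_sum_le {f : ℝ → ℝ} {n : ℕ} {M : ℝ} (hf : ContDiff ℝ (n + 1 : ℕ) f)
    (hM : ∀ x, |iteratedDeriv (n + 1) f x| ≤ M) (a h : ℝ) :
    |f (a + h) - ∑ j ∈ Finset.range (n + 1),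
        iteratedDeriv j f a * h ^ j / (Nat.factorial j : ℝ)| ≤
      M * |h| ^ (n + 1) / (Nat.factorial (n + 1) : ℝ) := by
  rcases eq_or_ne h 0 with rfl | hh
  · simp [Finset.sum_range_succ']
  have hne : a ≠ a + h := by simpa using hh
  obtain ⟨y, -, hy⟩ := taylor_mean_remainder_lagrange_iteratedDeriv (n := n) hne
    (by exact_mod_cast hf.contDiffOn)
  have hsum : taylorWithinEval f n (Set.uIcc a (a + h)) a (a + h) =
      ∑ j ∈ Finset.range (n + 1), iteratedDeriv j f a * h ^ j / (Nat.factorial j : ℝ) := by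
    rw [taylor_within_apply]
    refine Finset.sum_congr rfl fun j hj => ?_
    rw [iteratedDerivWithin_eq_iteratedDeriv (uniqueDiffOn_uIcc hne)
      (hf.of_le (by exact_mod_cast (Finset.mem_range.1 hj).le)).contDiffAt Set.left_mem_uIcc,
      add_sub_cancel_left, smul_eq_mul]
    ring
  rw [← hsum, hy, add_sub_cancel_left, abs_div, abs_mul, abs_pow, Nat.abs_cast]
  gcongr
  exact hM y

/-- **Even-moment Gaussian Taylor expansion**: for `φ` of class `C^{2m+2}` with bounded
`(2m+2)`-th derivative and `Z` a standard Gaussian,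
`|E[φ(a+σZ)] − Σ_{k=0}^m φ^{(2k)}(a) σ^{2k}/(2^k k!)|
  ≤ ((2m+1)!!/(2m+2)!) · sup|φ^{(2m+2)}| · σ^{2m+2}`,
all odd Gaussian moments vanishing and `E[Z^{2k}] = (2k−1)!! = (2k)!/(2^k k!)`. -/
theorem gaussian_even_taylor_expansion
    (m : ℕ) (φ : ℝ → ℝ)
    (hφ : ContDiff ℝ (2 * m + 2 : ℕ) φ)
    (hbd : ∃ M : ℝ, ∀ x : ℝ, |iteratedDeriv (2 * m + 2) φ x| ≤ M) :
    ∀ (a σ : ℝ), 0 ≤ σ →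
      |(∫ z, φ (a + σ * z) ∂ (gaussianReal 0 1)) -
          ∑ k ∈ Finset.range (m + 1),
            iteratedDeriv (2 * k) φ a * σ ^ (2 * k) / (2 ^ k * (Nat.factorial k : ℝ))| ≤
        ((Nat.doubleFactorial (2 * m + 1) : ℝ) / (Nat.factorial (2 * m + 2) : ℝ)) *
          sSup (Set.range fun x => |iteratedDeriv (2 * m + 2) φ x|) * σ ^ (2 * m + 2) := by
  intro a σ hσ
  obtain ⟨M, hM⟩ := hbd
  set S := sSup (Set.range fun x => |iteratedDeriv (2 * m + 2) φ x|)
  have hS (x : ℝ) : |iteratedDeriv (2 * m + 2) φ x| ≤ S :=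
    le_csSup ⟨M, by rintro _ ⟨y, rfl⟩; exact hM y⟩ ⟨x, rfl⟩
  let P : ℝ → ℝ := fun z => ∑ j ∈ Finset.range (2 * m + 2),
    iteratedDeriv j φ a * (σ * z) ^ j / (Nat.factorial j : ℝ)
  let c : ℝ := S * σ ^ (2 * m + 2) / (Nat.factorial (2 * m + 2) : ℝ)
  have hterm (j : ℕ) : (fun z : ℝ => iteratedDeriv j φ a * (σ * z) ^ j / (Nat.factorial j : ℝ)) =
      fun z => iteratedDeriv j φ a * σ ^ j / (Nat.factorial j : ℝ) * z ^ j := by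
    ext z
    ring
  have hterm_int (j : ℕ) : Integrable
      (fun z : ℝ => iteratedDeriv j φ a * (σ * z) ^ j / (Nat.factorial j : ℝ))
      (gaussianReal 0 1) := by
    rw [hterm]
    exact (integrable_pow_gaussianReal j).const_mul _
  have hP_int : Integrable P (gaussianReal 0 1) := integrable_finsetSum _ fun j _ => hterm_int j
  have hP : ∫ z, P z ∂(gaussianReal 0 1) = ∑ k ∈ Finset.range (m + 1),
      iteratedDeriv (2 * k) φ a * σ ^ (2 * k) / (2 ^ k * (Nat.factorial k : ℝ)) := by
    rw [integral_finsetSum _ fun j _ => hterm_int j, show 2 * m + 2 = 2 * (m + 1) by ring,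
      sum_range_two_mul_eq_sum_add]
    refine Finset.sum_congr rfl fun k _ => ?_
    rw [hterm, hterm, integral_const_mul, integral_const_mul, integral_pow_odd_gaussianReal,
      integral_pow_even_gaussianReal]
    have := Nat.factorial_ne_zero (2 * k)
    field_simp
    ring
  have hbound (z : ℝ) : ‖φ (a + σ * z) - P z‖ ≤ c * z ^ (2 * m + 2) := by
    refine (abs_sub_taylor_sum_le (n := 2 * m + 1) hφ hS a (σ * z)).trans_eq ?_
    rw [Even.pow_abs ⟨m + 1, by ring⟩]
    simp only [c]
    ring
  have hc_int : Integrable (fun z : ℝ => c * z ^ (2 * m + 2)) (gaussianReal 0 1) :=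
    (integrable_pow_gaussianReal _).const_mul c
  have hP_cont : Continuous P := by fun_prop
  have hφ_cont : Continuous φ := hφ.continuous
  have hR_int : Integrable (fun z => φ (a + σ * z) - P z) (gaussianReal 0 1) :=
    hc_int.mono' (by fun_prop) (Filter.Eventually.of_forall hbound)
  have hφ_int : Integrable (fun z => φ (a + σ * z)) (gaussianReal 0 1) := by
    exact (hR_int.add hP_int).congr (Filter.Eventually.of_forall fun z => sub_add_cancel _ _)
  rw [← hP, ← integral_sub hφ_int hP_int]
  refine (norm_integral_le_of_norm_le hc_int (Filter.Eventually.of_forall hbound)).trans_eq ?_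
  rw [integral_const_mul, integral_pow_even_gaussianReal_eq_doubleFactorial]
  simp only [c]
  ring
end
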